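/- arXiv:1612.01700 — 2 statements merged into one kernel-verified Lean document; each statement's English description precedes it below -/
import Mathlib

section
/- Let N ≥ 2, 1 ≤ k < N, let Ω ⊂ ℝ^N be a bounded open set, and let H : Ω × ℝ^N → ℝ be continuous and satisfy (SC2) and (SC3). If μ < μ̄ₖ⁺(Ω), then the maximum principle holds for 𝒫⁻ₖ(D²·) + H(x,∇·) + μ·: every upper semicontinuous viscosity subsolution u of 𝒫⁻ₖ(D²u) + H(x,∇u) + μu = 0 in Ω (that is, 𝒫⁻ₖ(D²u) + H(x,∇u) + μu ≥ 0 in the viscosity sense) with limsup_{x→∂Ω} u(x) ≤ 0 satisfies u ≤ 0 in Ω. -/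
open Metric Filter Topology Set

/-- `𝒫⁻ₖ(D²φ(x))`: the sum of the `k` smallest eigenvalues of the Hessian of `φ` at `x`,
expressed through the min-max representation over orthonormal `k`-frames. -/
noncomputable def Pminus {N : ℕ} (k : ℕ) (φ : EuclideanSpace ℝ (Fin N) → ℝ)
    (x : EuclideanSpace ℝ (Fin N)) : ℝ :=
  sInf {s : ℝ | ∃ ξ : Fin k → EuclideanSpace ℝ (Fin N), Orthonormal ℝ ξ ∧
    s = ∑ i, iteratedFDeriv ℝ 2 φ x ![ξ i, ξ i]}

/-- `𝒫⁺ₖ(D²φ(x))`: the sum of the `k` largest eigenvalues of the Hessian of `φ` at `x`. -/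
noncomputable def Pplus {N : ℕ} (k : ℕ) (φ : EuclideanSpace ℝ (Fin N) → ℝ)
    (x : EuclideanSpace ℝ (Fin N)) : ℝ :=
  sSup {s : ℝ | ∃ ξ : Fin k → EuclideanSpace ℝ (Fin N), Orthonormal ℝ ξ ∧
    s = ∑ i, iteratedFDeriv ℝ 2 φ x ![ξ i, ξ i]}

/-- Viscosity subsolution of `P(D²u) + H(x,∇u) + μ u = f(x)` in `Ω`:
for every `x₀ ∈ Ω` and every `C²` test function `φ` such that `u - φ` has a local
maximum (relative to `Ω`) at `x₀`, one has `P(D²φ(x₀)) + H(x₀,∇φ(x₀)) + μ u(x₀) ≥ f(x₀)`. -/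
def IsViscSubsol {N : ℕ}
    (P : (EuclideanSpace ℝ (Fin N) → ℝ) → EuclideanSpace ℝ (Fin N) → ℝ)
    (Ω : Set (EuclideanSpace ℝ (Fin N)))
    (H : EuclideanSpace ℝ (Fin N) → EuclideanSpace ℝ (Fin N) → ℝ)
    (μ : ℝ) (f : EuclideanSpace ℝ (Fin N) → ℝ)
    (u : EuclideanSpace ℝ (Fin N) → ℝ) : Prop :=
  ∀ x₀ ∈ Ω, ∀ φ : EuclideanSpace ℝ (Fin N) → ℝ, ContDiffAt ℝ 2 φ x₀ →
    IsLocalMaxOn (fun x => u x - φ x) Ω x₀ →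
    f x₀ ≤ P φ x₀ + H x₀ (gradient φ x₀) + μ * u x₀

/-- Viscosity supersolution of `P(D²u) + H(x,∇u) + μ u = f(x)` in `Ω`. -/
def IsViscSupersol {N : ℕ}
    (P : (EuclideanSpace ℝ (Fin N) → ℝ) → EuclideanSpace ℝ (Fin N) → ℝ)
    (Ω : Set (EuclideanSpace ℝ (Fin N)))
    (H : EuclideanSpace ℝ (Fin N) → EuclideanSpace ℝ (Fin N) → ℝ)
    (μ : ℝ) (f : EuclideanSpace ℝ (Fin N) → ℝ)
    (u : EuclideanSpace ℝ (Fin N) → ℝ) : Prop :=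
  ∀ x₀ ∈ Ω, ∀ φ : EuclideanSpace ℝ (Fin N) → ℝ, ContDiffAt ℝ 2 φ x₀ →
    IsLocalMinOn (fun x => u x - φ x) Ω x₀ →
    P φ x₀ + H x₀ (gradient φ x₀) + μ * u x₀ ≤ f x₀

/-- Structure condition (SC1): `|H(x,ξ)| ≤ b‖ξ‖`. -/
def SC1 {N : ℕ} (Ω : Set (EuclideanSpace ℝ (Fin N)))
    (H : EuclideanSpace ℝ (Fin N) → EuclideanSpace ℝ (Fin N) → ℝ) (b : ℝ) : Prop :=
  ∀ x ∈ Ω, ∀ ξ : EuclideanSpace ℝ (Fin N), |H x ξ| ≤ b * ‖ξ‖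

/-- Structure condition (SC2): positive 1-homogeneity in the gradient variable. -/
def SC2 {N : ℕ} (Ω : Set (EuclideanSpace ℝ (Fin N)))
    (H : EuclideanSpace ℝ (Fin N) → EuclideanSpace ℝ (Fin N) → ℝ) : Prop :=
  ∀ x ∈ Ω, ∀ t : ℝ, 0 ≤ t → ∀ ξ : EuclideanSpace ℝ (Fin N), H x (t • ξ) = t * H x ξ

/-- Structure condition (SC3): uniform continuity in `x` through a modulus of continuity. -/
def SC3 {N : ℕ} (Ω : Set (EuclideanSpace ℝ (Fin N)))
    (H : EuclideanSpace ℝ (Fin N) → EuclideanSpace ℝ (Fin N) → ℝ) : Prop :=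
  ∃ ω : ℝ → ℝ, Monotone ω ∧ Filter.Tendsto ω (𝓝[>] (0 : ℝ)) (𝓝 (0 : ℝ)) ∧
    ∀ x ∈ Ω, ∀ y ∈ Ω, ∀ ξ : EuclideanSpace ℝ (Fin N),
      |H x ξ - H y ξ| ≤ ω (‖x - y‖ * (1 + ‖ξ‖))

/-- `Ω ∈ 𝒞_R`: a "hula hoop" domain, i.e. an intersection of a nonempty family of
open balls of the common radius `R`. -/
def HulaHoop {N : ℕ} (R : ℝ) (Ω : Set (EuclideanSpace ℝ (Fin N))) : Prop :=
  ∃ Y : Set (EuclideanSpace ℝ (Fin N)), Y.Nonempty ∧ Ω = ⋂ y ∈ Y, ball y R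

/-- `μ̄ₖ⁻(Ω)`: the supremum (in `EReal`) of those `μ` for which there is an upper
semicontinuous `w < 0` on `cl(Ω)` which is a viscosity subsolution of
`𝒫⁻ₖ(D²w) + H(x,∇w) + μ w = 0` in `Ω`. -/
noncomputable def muBarMinus {N : ℕ} (k : ℕ) (Ω : Set (EuclideanSpace ℝ (Fin N)))
    (H : EuclideanSpace ℝ (Fin N) → EuclideanSpace ℝ (Fin N) → ℝ) : EReal :=
  sSup {m : EReal | ∃ μ : ℝ, m = (μ : EReal) ∧ ∃ w : EuclideanSpace ℝ (Fin N) → ℝ,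
    UpperSemicontinuousOn w (closure Ω) ∧ (∀ x ∈ closure Ω, w x < 0) ∧
    IsViscSubsol (Pminus k) Ω H μ (fun _ => 0) w}

/-- `μₖ⁻(Ω)`: as `μ̄ₖ⁻(Ω)`, but only requiring `w < 0` (and upper semicontinuous) in `Ω`. -/
noncomputable def muMinus {N : ℕ} (k : ℕ) (Ω : Set (EuclideanSpace ℝ (Fin N)))
    (H : EuclideanSpace ℝ (Fin N) → EuclideanSpace ℝ (Fin N) → ℝ) : EReal :=
  sSup {m : EReal | ∃ μ : ℝ, m = (μ : EReal) ∧ ∃ w : EuclideanSpace ℝ (Fin N) → ℝ,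
    UpperSemicontinuousOn w Ω ∧ (∀ x ∈ Ω, w x < 0) ∧
    IsViscSubsol (Pminus k) Ω H μ (fun _ => 0) w}

/-- `μ̄ₖ⁺(Ω)`: the supremum (in `EReal`) of those `μ` for which there is a lower
semicontinuous `w > 0` on `cl(Ω)` which is a viscosity supersolution of
`𝒫⁻ₖ(D²w) + H(x,∇w) + μ w = 0` in `Ω`. -/
noncomputable def muBarPlus {N : ℕ} (k : ℕ) (Ω : Set (EuclideanSpace ℝ (Fin N)))
    (H : EuclideanSpace ℝ (Fin N) → EuclideanSpace ℝ (Fin N) → ℝ) : EReal :=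
  sSup {m : EReal | ∃ μ : ℝ, m = (μ : EReal) ∧ ∃ w : EuclideanSpace ℝ (Fin N) → ℝ,
    LowerSemicontinuousOn w (closure Ω) ∧ (∀ x ∈ closure Ω, 0 < w x) ∧
    IsViscSupersol (Pminus k) Ω H μ (fun _ => 0) w}

/-- `μₖ⁺(Ω)`: as `μ̄ₖ⁺(Ω)`, but only requiring `w > 0` (and lower semicontinuous) in `Ω`. -/
noncomputable def muPlus {N : ℕ} (k : ℕ) (Ω : Set (EuclideanSpace ℝ (Fin N)))
    (H : EuclideanSpace ℝ (Fin N) → EuclideanSpace ℝ (Fin N) → ℝ) : EReal :=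
  sSup {m : EReal | ∃ μ : ℝ, m = (μ : EReal) ∧ ∃ w : EuclideanSpace ℝ (Fin N) → ℝ,
    LowerSemicontinuousOn w Ω ∧ (∀ x ∈ Ω, 0 < w x) ∧
    IsViscSupersol (Pminus k) Ω H μ (fun _ => 0) w}

section Alexandrov

set_option linter.unusedSectionVars false

open MeasureTheory
open scoped RealInnerProductSpace NNReal

variable {E : Type*} [NormedAddCommGroup E] [InnerProductSpace ℝ E] [FiniteDimensional ℝ E]

lemma aux_coercive_min {g : E → ℝ} (hg : Continuous g) {κ L C : ℝ} (hκ : 0 < κ)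
    (h : ∀ x, κ * ‖x‖ ^ 2 - L * ‖x‖ - C ≤ g x) : ∃ x, ∀ y, g x ≤ g y := by
  have : ProperSpace E := FiniteDimensional.proper ℝ E
  apply hg.exists_forall_le
  refine tendsto_atTop_mono h ?_
  have h1 : Tendsto (fun t : ℝ => t * (κ * t - L) - C) atTop atTop := by
    apply tendsto_atTop_add_const_right
    apply tendsto_id.atTop_mul_atTop₀
    apply tendsto_atTop_add_const_right
    exact tendsto_id.const_mul_atTop hκ
  refine (h1.comp (tendsto_norm_cocompact_atTop (E := E))).congr ?_
  intro x
  simp only [Function.comp]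
  ring

variable {f : E → ℝ} {q : E → E} {L : ℝ}

lemma aux_lip (hq : ∀ x z, f x + ⟪q x, z - x⟫ ≤ f z) (hL : ∀ x, ‖q x‖ ≤ L) (x z : E) :
    f x - L * ‖z - x‖ ≤ f z := by
  have h1 := hq x z
  have h2 := abs_le.1 (abs_real_inner_le_norm (q x) (z - x))
  have h3 := mul_le_mul_of_nonneg_right (hL x) (norm_nonneg (z - x))
  linarith [h2.1]

lemma aux_cont (hq : ∀ x z, f x + ⟪q x, z - x⟫ ≤ f z) (hL : ∀ x, ‖q x‖ ≤ L) :
    Continuous f := by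
  have hL0 : 0 ≤ L := (norm_nonneg _).trans (hL 0)
  have : LipschitzWith ⟨L, hL0⟩ f := by
    apply LipschitzWith.of_le_add_mul
    intro x y
    have := aux_lip hq hL x y
    rw [dist_comm, dist_eq_norm]
    change f x ≤ f y + L * _
    linarith
  exact this.continuous

lemma aux_convex (hq : ∀ x z, f x + ⟪q x, z - x⟫ ≤ f z) (x z : E) {t : ℝ} (h0 : 0 ≤ t)
    (h1 : t ≤ 1) : f (x + t • (z - x)) ≤ f x + t * (f z - f x) := by
  have a := hq (x + t • (z - x)) x
  have b := hq (x + t • (z - x)) z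
  have e1 : x - (x + t • (z - x)) = (-t) • (z - x) := by module
  have e2 : z - (x + t • (z - x)) = (1 - t) • (z - x) := by module
  rw [e1, inner_smul_right] at a
  rw [e2, inner_smul_right] at b
  nlinarith

lemma aux_prox (hq : ∀ x z, f x + ⟪q x, z - x⟫ ≤ f z) (hL : ∀ x, ‖q x‖ ≤ L) :
    ∃ G : E → E, ∀ y z, f (G y) + ⟪y - G y, z - G y⟫ ≤ f z := by
  suffices ∀ y, ∃ x, ∀ z, f x + ⟪y - x, z - x⟫ ≤ f z by
    choose G hG using this
    exact ⟨G, hG⟩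
  intro y
  have hc := aux_cont hq hL
  obtain ⟨x, hx⟩ := aux_coercive_min (g := fun x => f x + (1/2) * ‖x - y‖ ^ 2)
    (κ := 1/2) (L := L + ‖y‖) (C := - f 0) (by fun_prop) (by norm_num) (by
      intro x
      have h1 := aux_lip hq hL 0 x
      have h2 := abs_le.1 (abs_real_inner_le_norm x y)
      rw [sub_zero] at h1
      rw [norm_sub_sq_real]
      nlinarith [h2.2, sq_nonneg ‖y‖])
  refine ⟨x, fun z => ?_⟩
  have key : ∀ t : ℝ, 0 < t → t ≤ 1 →
      f x + ⟪y - x, z - x⟫ ≤ f z + t * ((1/2) * ‖z - x‖ ^ 2) := by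
    intro t ht0 ht1
    have h1 := hx (x + t • (z - x))
    have h2 := aux_convex hq x z ht0.le ht1
    have e : x + t • (z - x) - y = t • (z - x) - (y - x) := by module
    rw [e, norm_sub_sq_real (t • (z - x)), ← norm_neg (x - y), neg_sub, inner_smul_left, norm_smul, mul_pow,
      real_inner_comm] at h1
    simp only [Real.norm_eq_abs, sq_abs, conj_trivial] at h1
    have h3 : t * ⟪y - x, z - x⟫ ≤ t * (f z - f x + t * ((1/2) * ‖z - x‖ ^ 2)) := by nlinarith
    have := le_of_mul_le_mul_left h3 ht0
    linarith
  have lim : Tendsto (fun t : ℝ => f z + t * ((1/2) * ‖z - x‖ ^ 2)) (𝓝[>] 0)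
      (𝓝 (f z + 0 * ((1/2) * ‖z - x‖ ^ 2))) := by
    apply Tendsto.mono_left _ nhdsWithin_le_nhds
    exact Continuous.tendsto (by fun_prop) 0
  rw [zero_mul, add_zero] at lim
  refine ge_of_tendsto lim ?_
  filter_upwards [Ioc_mem_nhdsGT (show (0:ℝ) < 1 by norm_num)] with t ht
  exact key t ht.1 ht.2

/-- monotonicity of subgradients, firm nonexpansiveness -/
lemma aux_firm {G : E → E} (hG : ∀ y z, f (G y) + ⟪y - G y, z - G y⟫ ≤ f z) (y y' : E) :
    ‖G y' - G y‖ ^ 2 ≤ ⟪G y' - G y, y' - y⟫ := by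
  have a := hG y (G y')
  have b := hG y' (G y)
  have e : G y - G y' = - (G y' - G y) := by abel
  rw [e, inner_neg_right] at b
  have c : ⟪y - G y, G y' - G y⟫ - ⟪y' - G y', G y' - G y⟫ ≤ 0 := by linarith
  rw [← inner_sub_left] at c
  have e2 : y - G y - (y' - G y') = (G y' - G y) - (y' - y) := by abel
  rw [e2, inner_sub_left, real_inner_self_eq_norm_sq, real_inner_comm] at c
  linarith

lemma aux_prox_eq (hq : ∀ x z, f x + ⟪q x, z - x⟫ ≤ f z) {G : E → E}
    (hG : ∀ y z, f (G y) + ⟪y - G y, z - G y⟫ ≤ f z) (x : E) : G (x + q x) = x := by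
  have a := hG (x + q x) x
  have b := hq x (G (x + q x))
  set g := G (x + q x)
  have e : x + q x - g = (x - g) + q x := by abel
  have e2 : g - x = - (x - g) := by abel
  rw [e, inner_add_left, real_inner_self_eq_norm_sq] at a
  rw [e2, inner_neg_right] at b
  have : ‖x - g‖ ^ 2 ≤ 0 := by linarith
  have h : ‖x - g‖ = 0 := by nlinarith [norm_nonneg (x - g)]
  exact (sub_eq_zero.1 (norm_eq_zero.1 h)).symm

lemma aux_prox_lip {G : E → E} (hG : ∀ y z, f (G y) + ⟪y - G y, z - G y⟫ ≤ f z) :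
    LipschitzWith 1 G := by
  apply LipschitzWith.of_dist_le_mul
  intro y' y
  have h := aux_firm hG y y'
  have h2 := real_inner_le_norm (G y' - G y) (y' - y)
  rw [dist_eq_norm, dist_eq_norm, NNReal.coe_one, one_mul]
  by_contra hc
  push Not at hc
  nlinarith [norm_nonneg (G y' - G y), norm_nonneg (y' - y)]

/-- second order expansion of the subgradient selection -/
lemma aux_subgrad_diff (hq : ∀ x z, f x + ⟪q x, z - x⟫ ≤ f z) {G : E → E}
    (hG : ∀ y z, f (G y) + ⟪y - G y, z - G y⟫ ≤ f z) (x : E) (S : E →L[ℝ] E)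
    (hS : HasFDerivAt G S (x + q x)) (hdet : S.det ≠ 0) :
    ∃ B : E →L[ℝ] E, ∀ ε > 0, ∃ r > 0, ∀ h : E, ‖h‖ < r →
      ‖q (x + h) - q x - B h‖ ≤ ε * ‖h‖ := by
  set T := S.toContinuousLinearEquivOfDetNeZero hdet with hT
  have hTS : ∀ v, T v = S v := fun v => rfl
  set y := x + q x with hy
  have hGy : G y = x := aux_prox_eq hq hG x
  -- lower bound for S
  have hinv : ∀ v, ‖v‖ ≤ ‖(T.symm : E →L[ℝ] E)‖ * ‖S v‖ := by
    intro v
    have := (T.symm : E →L[ℝ] E).le_opNorm (S v)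
    rwa [← hTS, ContinuousLinearEquiv.coe_coe, T.symm_apply_apply] at this
  set m := ‖(T.symm : E →L[ℝ] E)‖ + 1 with hm
  have hm0 : 0 < m := by positivity
  have hinv' : ∀ v, ‖v‖ ≤ m * ‖S v‖ := fun v => (hinv v).trans (by
    gcongr; linarith)
  -- monotone
  have hmon : ∀ v, ‖S v‖ ^ 2 ≤ ⟪S v, v⟫ := by
    intro v
    have hl : Tendsto (fun t : ℝ => t⁻¹ • (G (y + t • v) - G y)) (𝓝[≠] 0) (𝓝 (S v)) := by
      have := (hS.hasLineDerivAt v).tendsto_slope_zero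
      exact this
    refine le_of_tendsto_of_tendsto (hl.norm.pow 2) (hl.inner tendsto_const_nhds) ?_
    filter_upwards [self_mem_nhdsWithin] with t ht
    have ht : t ≠ 0 := ht
    have h := aux_firm hG y (y + t • v)
    rw [add_sub_cancel_left, inner_smul_right] at h
    simp only [norm_smul, mul_pow, norm_inv, Real.norm_eq_abs, inner_smul_left, conj_trivial,
      sq_abs, inv_pow]
    calc (t ^ 2)⁻¹ * ‖G (y + t • v) - G y‖ ^ 2
        ≤ (t ^ 2)⁻¹ * (t * ⟪G (y + t • v) - G y, v⟫) := by gcongr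
      _ = _ := by field_simp
  set c := 1 / m ^ 2 with hc
  have hc0 : 0 < c := by positivity
  have hcoer : ∀ v, c * ‖v‖ ^ 2 ≤ ⟪S v, v⟫ := by
    intro v
    refine le_trans ?_ (hmon v)
    have : ‖v‖ ^ 2 ≤ m ^ 2 * ‖S v‖ ^ 2 := by
      rw [← mul_pow]; exact pow_le_pow_left₀ (norm_nonneg _) (hinv' v) 2
    rw [hc, one_div, inv_mul_le_iff₀ (by positivity)]
    exact this
  have hdiff : ∀ ε > 0, ∃ r > 0, ∀ v, ‖v‖ < r → ‖G (y + v) - x - S v‖ ≤ ε * ‖v‖ := by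
    intro ε hε
    have := hS.isLittleO
    have h1 := (Asymptotics.isLittleO_iff.1 this) hε
    obtain ⟨r, hr, h2⟩ := Metric.eventually_nhds_iff.1 h1
    refine ⟨r, hr, fun v hv => ?_⟩
    have := h2 (y := y + v) (by simpa [dist_eq_norm] using hv)
    simpa [hGy] using this
  -- local linear bound
  have hlin : ∀ v, ∀ ρ, (∀ v, ‖v‖ < ρ → ‖G (y + v) - x - S v‖ ≤ (c/2) * ‖v‖) → ‖v‖ < ρ →
      (c / 2) * ‖v‖ ^ 2 ≤ ⟪G (y + v) - x, v⟫ := by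
    intro v ρ h hv
    have h1 := h v hv
    have h2 := hcoer v
    have h3 := abs_le.1 (abs_real_inner_le_norm (G (y + v) - x - S v) v)
    rw [inner_sub_left] at h3
    have h4 := mul_le_mul_of_nonneg_right h1 (norm_nonneg v)
    nlinarith [h3.1]
  obtain ⟨ρ, hρ, hρ'⟩ := hdiff (c/2) (by positivity)
  -- q(x+h) close
  set Y : E → E := fun h => (x + h) + q (x + h) - y with hY
  have hGY : ∀ h, G (y + Y h) = x + h := by
    intro h
    have : y + Y h = (x + h) + q (x + h) := by simp [hY]
    rw [this]; exact aux_prox_eq hq hG _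
  have hYb : ∀ h, ‖h‖ < (c / 2) * (ρ / 2) → ‖Y h‖ < ρ ∧ (c / 2) * ‖Y h‖ ≤ ‖h‖ := by
    intro h hh
    have hlt : ‖Y h‖ < ρ := by
      by_contra hcon
      push Not at hcon
      have hpos : 0 < ‖Y h‖ := hρ.trans_le hcon
      set s := (ρ / 2) / ‖Y h‖ with hs
      have hs0 : 0 < s := by positivity
      have hs1 : s < 1 := by rw [hs, div_lt_one hpos]; linarith
      have hn : ‖s • Y h‖ = ρ / 2 := by
        rw [norm_smul, Real.norm_eq_abs, abs_of_pos hs0, hs]; field_simp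
      have h1 := hlin (s • Y h) ρ hρ' (by rw [hn]; linarith)
      have h2 := aux_firm hG (y + s • Y h) (y + Y h)
      have h2' : 0 ≤ ⟪G (y + Y h) - G (y + s • Y h), y + Y h - (y + s • Y h)⟫ :=
        (sq_nonneg _).trans h2
      have e : y + Y h - (y + s • Y h) = (1 - s) • Y h := by module
      rw [e, inner_smul_right, hGY] at h2'
      have h3 : 0 ≤ ⟪x + h - G (y + s • Y h), Y h⟫ := by
        by_contra hc'
        push Not at hc'
        nlinarith
      have e2 : x + h - G (y + s • Y h) = h - (G (y + s • Y h) - x) := by abel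
      rw [e2, inner_sub_left] at h3
      rw [inner_smul_right, hn] at h1
      have h4 := real_inner_le_norm h (Y h)
      have h5 : s * (‖h‖ * ‖Y h‖) = ‖h‖ * (ρ / 2) := by
        rw [hs]; field_simp
      have h6 : s * ⟪G (y + s • Y h) - x, Y h⟫ ≤ s * (‖h‖ * ‖Y h‖) := by
        apply mul_le_mul_of_nonneg_left _ hs0.le; linarith
      rw [h5] at h6
      nlinarith
    refine ⟨hlt, ?_⟩
    have h1 := hlin (Y h) ρ hρ' hlt
    rw [hGY, add_sub_cancel_left] at h1
    have h4 := real_inner_le_norm h (Y h)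
    rcases (norm_nonneg (Y h)).eq_or_lt with h0 | h0
    · rw [← h0]; simp
    · have : (c / 2 * ‖Y h‖) * ‖Y h‖ ≤ ‖h‖ * ‖Y h‖ := by nlinarith
      exact le_of_mul_le_mul_right this h0
  refine ⟨(T.symm : E →L[ℝ] E) - ContinuousLinearMap.id ℝ E, fun ε hε => ?_⟩
  obtain ⟨r, hr, hr'⟩ := hdiff (ε * (c / 2) / m) (by positivity)
  refine ⟨min ((c / 2) * (ρ / 2)) ((c / 2) * r), by positivity, fun h hh => ?_⟩
  obtain ⟨h1, h2⟩ := hYb h (hh.trans_le (min_le_left _ _))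
  have h3 : ‖h‖ < (c / 2) * r := hh.trans_le (min_le_right _ _)
  have h4 : ‖Y h‖ < r := by
    have : c / 2 * ‖Y h‖ < c / 2 * r := h2.trans_lt h3
    exact lt_of_mul_lt_mul_left this (by positivity)
  have h5 := hr' (Y h) h4
  rw [hGY, add_sub_cancel_left] at h5
  have e : q (x + h) - q x - ((T.symm : E →L[ℝ] E) - ContinuousLinearMap.id ℝ E) h
      = - T.symm (h - S (Y h)) := by
    rw [map_sub, ← hTS (Y h), T.symm_apply_apply]
    simp only [hY, hy, sub_apply, ContinuousLinearEquiv.coe_coe,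
      ContinuousLinearMap.id_apply]
    abel
  rw [e, norm_neg]
  calc ‖T.symm (h - S (Y h))‖ ≤ ‖(T.symm : E →L[ℝ] E)‖ * ‖h - S (Y h)‖ :=
        (T.symm : E →L[ℝ] E).le_opNorm _
    _ ≤ m * ((ε * (c / 2) / m) * ‖Y h‖) := by gcongr; linarith
    _ = ε * ((c / 2) * ‖Y h‖) := by field_simp
    _ ≤ ε * ‖h‖ := by gcongr

/-- second order expansion of the function from first order expansion of the subgradient -/
lemma aux_second (hq : ∀ x z, f x + ⟪q x, z - x⟫ ≤ f z) (x : E) (B : E →L[ℝ] E)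
    (hB : ∀ ε > 0, ∃ r > 0, ∀ h : E, ‖h‖ < r → ‖q (x + h) - q x - B h‖ ≤ ε * ‖h‖) :
    ∀ ε > 0, ∃ r > 0, ∀ h : E, ‖h‖ < r →
      |f (x + h) - f x - ⟪q x, h⟫ - (1/2) * ⟪B h, h⟫| ≤ ε * ‖h‖ ^ 2 := by
  intro ε hε
  obtain ⟨r, hr, H⟩ := hB ε hε
  refine ⟨r, hr, fun h hh => ?_⟩
  set b := ⟪B h, h⟫ with hb
  -- slopes
  have slope : ∀ t : ℝ, 0 ≤ t → t ≤ 1 →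
      |⟪q (x + t • h), h⟫ - ⟪q x, h⟫ - t * b| ≤ ε * ‖h‖ ^ 2 := by
    intro t h0 h1
    have hn : ‖t • h‖ ≤ ‖h‖ := by
      rw [norm_smul, Real.norm_eq_abs, abs_of_nonneg h0]
      nlinarith [norm_nonneg h]
    have h2 := H (t • h) (hn.trans_lt hh)
    have h3 := abs_real_inner_le_norm (q (x + t • h) - q x - B (t • h)) h
    rw [inner_sub_left, inner_sub_left, map_smul, inner_smul_left] at h3
    simp only [conj_trivial] at h3
    refine h3.trans ?_
    have h4 := h2.trans (mul_le_mul_of_nonneg_left hn hε.le)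
    rw [map_smul] at h4
    nlinarith [norm_nonneg h]
  set g : ℝ → ℝ := fun t => f (x + t • h) - t * ⟪q x, h⟫ - (1/2) * t ^ 2 * b with hg
  have step : ∀ s t : ℝ, 0 ≤ s → s ≤ t → t ≤ 1 →
      |g t - g s| ≤ (t - s) * (ε * ‖h‖ ^ 2) + (t - s) ^ 2 * |b| := by
    intro s t h0 hst h1
    have a1 := hq (x + s • h) (x + t • h)
    have a2 := hq (x + t • h) (x + s • h)
    have e1 : x + t • h - (x + s • h) = (t - s) • h := by module
    have e2 : x + s • h - (x + t • h) = (-(t - s)) • h := by module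
    rw [e1, inner_smul_right] at a1
    rw [e2, inner_smul_right] at a2
    have s1 := abs_le.1 (slope s h0 (hst.trans h1))
    have s2 := abs_le.1 (slope t (h0.trans hst) h1)
    have d : 0 ≤ t - s := by linarith
    have m1 := mul_le_mul_of_nonneg_left s1.1 d
    have m2 := mul_le_mul_of_nonneg_left s2.2 d
    have k1 := mul_le_mul_of_nonneg_left (neg_abs_le b) (sq_nonneg (t - s))
    have k2 := mul_le_mul_of_nonneg_left (le_abs_self b) (sq_nonneg (t - s))
    have k3 : 0 ≤ (t - s) ^ 2 * |b| := by positivity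
    simp only [hg]
    rw [abs_le]
    constructor <;> nlinarith
  have tele : ∀ n : ℕ, 0 < n → |g 1 - g 0| ≤ ε * ‖h‖ ^ 2 + |b| * (1 / (n : ℝ)) := by
    intro n hn
    have hn' : (0:ℝ) < n := by exact_mod_cast hn
    have : ∀ m : ℕ, m ≤ n → |g ((m:ℝ) / n) - g 0| ≤
        m * ((1 / n) * (ε * ‖h‖ ^ 2) + (1 / n) ^ 2 * |b|) := by
      intro m
      induction m with
      | zero => intro _; simp
      | succ m ih =>
        intro hm
        have i1 := ih (by omega)
        have hm' : ((m:ℝ) + 1) ≤ n := by exact_mod_cast hm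
        have i2 := step ((m:ℝ) / n) (((m + 1 : ℕ) : ℝ) / n) (by positivity)
          (by gcongr; simp) (by rw [div_le_one hn']; exact_mod_cast hm)
        have e : ((m + 1 : ℕ) : ℝ) / n - (m:ℝ) / n = 1 / n := by
          push_cast; field_simp; ring
        rw [e] at i2
        have := abs_sub_le (g (((m + 1 : ℕ) : ℝ) / n)) (g ((m:ℝ) / n)) (g 0)
        push_cast at *
        linarith
    have h1 := this n le_rfl
    rw [div_self hn'.ne'] at h1
    refine h1.trans (le_of_eq ?_)
    field_simp
  have lim : Tendsto (fun n : ℕ => ε * ‖h‖ ^ 2 + |b| * (1 / (n : ℝ))) atTop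
      (𝓝 (ε * ‖h‖ ^ 2 + |b| * 0)) :=
    tendsto_const_nhds.add (tendsto_const_nhds.mul tendsto_one_div_atTop_nhds_zero_nat)
  rw [mul_zero, add_zero] at lim
  have fin := ge_of_tendsto lim ((eventually_gt_atTop 0).mono tele)
  have e : g 1 - g 0 = f (x + h) - f x - ⟪q x, h⟫ - (1/2) * b := by
    simp [hg]; ring
  rwa [e] at fin

variable [MeasurableSpace E] [BorelSpace E]

/-- Alexandrov -/
lemma aux_alexandrov (hq : ∀ x z, f x + ⟪q x, z - x⟫ ≤ f z) (hL : ∀ x, ‖q x‖ ≤ L) :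
    ∀ᵐ x ∂(μH[Module.finrank ℝ E] : Measure E), ∃ B : E →L[ℝ] E, ∀ ε > 0, ∃ r > 0, ∀ h : E, ‖h‖ < r →
      |f (x + h) - f x - ⟪q x, h⟫ - (1/2) * ⟪B h, h⟫| ≤ ε * ‖h‖ ^ 2 := by
  obtain ⟨G, hG⟩ := aux_prox hq hL
  have hlip := aux_prox_lip hG
  set ν : Measure E := μH[Module.finrank ℝ E] with hν
  have h1 : ν (G '' {y | ¬ DifferentiableAt ℝ G y}) = 0 := by
    have a : ν {y | ¬ DifferentiableAt ℝ G y} = 0 := hlip.ae_differentiableAt (μ := ν)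
    have := hlip.hausdorffMeasure_image_le (d := Module.finrank ℝ E) (by positivity)
      {y | ¬ DifferentiableAt ℝ G y}
    rw [← hν, a, mul_zero] at this
    exact le_antisymm this (zero_le)
  have h2 : ν (G '' {y | DifferentiableAt ℝ G y ∧ (fderiv ℝ G y).det = 0}) = 0 := by
    apply addHaar_image_eq_zero_of_det_fderivWithin_eq_zero (f' := fderiv ℝ G)
    · intro y hy
      exact hy.1.hasFDerivAt.hasFDerivWithinAt
    · intro y hy; exact hy.2
  have h3 := measure_union_null h1 h2
  rw [ae_iff]
  refine measure_mono_null ?_ h3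
  intro x hx
  by_contra hcon
  apply hx
  have hd : DifferentiableAt ℝ G (x + q x) := by
    by_contra hn
    exact hcon (Or.inl ⟨x + q x, hn, aux_prox_eq hq hG x⟩)
  have hdet : (fderiv ℝ G (x + q x)).det ≠ 0 := by
    intro hn
    exact hcon (Or.inr ⟨x + q x, ⟨hd, hn⟩, aux_prox_eq hq hG x⟩)
  obtain ⟨B, hB⟩ := aux_subgrad_diff hq hG x _ hd.hasFDerivAt hdet
  exact ⟨B, aux_second hq x B hB⟩

lemma aux_lin_zero {d : E} {c : ℝ} (h : ∀ v, ⟪d, v⟫ ≤ c * ‖v‖ ^ 2) : d = 0 := by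
  have h1 := h ((1 / (|c| + 1)) • d)
  rw [inner_smul_right, norm_smul, mul_pow, real_inner_self_eq_norm_sq, Real.norm_eq_abs,
    sq_abs] at h1
  have hc : 0 < |c| + 1 := by positivity
  have h2 : (|c| + 1) * ‖d‖ ^ 2 ≤ c * ‖d‖ ^ 2 := by
    have := mul_le_mul_of_nonneg_left h1 (sq_nonneg (|c| + 1))
    have e1 : (|c| + 1) ^ 2 * (1 / (|c| + 1) * ‖d‖ ^ 2) = (|c| + 1) * ‖d‖ ^ 2 := by field_simp
    have e2 : (|c| + 1) ^ 2 * (c * ((1 / (|c| + 1)) ^ 2 * ‖d‖ ^ 2)) = c * ‖d‖ ^ 2 := by field_simp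
    rwa [e1, e2] at this
  have h3 : ‖d‖ ^ 2 ≤ 0 := by nlinarith [le_abs_self c, sq_nonneg ‖d‖]
  have : ‖d‖ = 0 := by nlinarith [norm_nonneg d]
  exact norm_eq_zero.1 this

lemma aux_contact_lip {F : E → ℝ} {c : ℝ} (hc : 0 < c) {x x' p p' : E}
    (h1 : ∀ z, F z ≤ F x + ⟪p, z - x⟫) (h1' : ∀ z, F z ≤ F x' + ⟪p', z - x'⟫)
    (h2 : ∀ z, F x + ⟪p, z - x⟫ - c * ‖z - x‖ ^ 2 ≤ F z) :
    ‖p - p'‖ ≤ 4 * c * ‖x - x'‖ := by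
  set d := p - p' with hd
  set z := x' + (1 / (4 * c)) • d with hz
  have a := h2 z
  have b := h1' z
  have e := h1 x'
  have k : ⟪d, z - x'⟫ ≤ c * ‖z - x‖ ^ 2 := by
    have e1 : ⟪p, z - x⟫ = ⟪p, z - x'⟫ + ⟪p, x' - x⟫ := by
      rw [← inner_add_right]; congr 1; abel
    rw [hd, inner_sub_left]
    linarith
  have e3 : z - x' = (1 / (4 * c)) • d := by simp [hz]
  rw [e3, inner_smul_right, real_inner_self_eq_norm_sq] at k
  have n : ‖z - x‖ ≤ ‖x - x'‖ + 1 / (4 * c) * ‖d‖ := by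
    have : z - x = -(x - x') + (1 / (4 * c)) • d := by rw [hz]; abel
    rw [this]
    refine (norm_add_le _ _).trans ?_
    rw [norm_neg, norm_smul, Real.norm_eq_abs, abs_of_pos (by positivity : 0 < 1 / (4 * c))]
  have k2 : 1 / (4 * c) * ‖d‖ ^ 2 ≤ c * (‖x - x'‖ + 1 / (4 * c) * ‖d‖) ^ 2 :=
    k.trans (by gcongr)
  have k3 : (2 * ‖d‖) ^ 2 ≤ (4 * c * ‖x - x'‖ + ‖d‖) ^ 2 := by
    have := mul_le_mul_of_nonneg_left k2 (by positivity : 0 ≤ 16 * c)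
    have e1 : 16 * c * (1 / (4 * c) * ‖d‖ ^ 2) = (2 * ‖d‖) ^ 2 := by field_simp; ring
    have e2 : 16 * c * (c * (‖x - x'‖ + 1 / (4 * c) * ‖d‖) ^ 2)
        = (4 * c * ‖x - x'‖ + ‖d‖) ^ 2 := by field_simp; ring
    rwa [e1, e2] at this
  have k4 := abs_le_of_sq_le_sq k3 (by positivity)
  linarith [le_abs_self (2 * ‖d‖)]

lemma aux_expand_sq (x z : E) : ‖z‖ ^ 2 = ‖x‖ ^ 2 + 2 * ⟪x, z - x⟫ + ‖z - x‖ ^ 2 := by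
  have : z = x + (z - x) := by abel
  conv_lhs => rw [this]
  rw [norm_add_sq_real]

/-- Jensen + Alexandrov -/
lemma aux_jensen {f₁ f₂ : E → ℝ} {q₁ q₂ : E → E} {L κ δ : ℝ} (hκ : 0 < κ) (hδ : 0 < δ)
    (hq₁ : ∀ x z, f₁ x + ⟪q₁ x, z - x⟫ ≤ f₁ z) (hL₁ : ∀ x, ‖q₁ x‖ ≤ L)
    (hq₂ : ∀ x z, f₂ x + ⟪q₂ x, z - x⟫ ≤ f₂ z) (hL₂ : ∀ x, ‖q₂ x‖ ≤ L) :
    ∃ x p : E, ‖p‖ < δ ∧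
      (∀ z, f₁ z + f₂ z - κ * ‖z‖ ^ 2 ≤ f₁ x + f₂ x - κ * ‖x‖ ^ 2 + ⟪p, z - x⟫) ∧
      q₁ x + q₂ x - (2 * κ) • x = p ∧
      (∃ B : E →L[ℝ] E, ∀ ε > 0, ∃ r > 0, ∀ h : E, ‖h‖ < r →
        |f₁ (x + h) - f₁ x - ⟪q₁ x, h⟫ - (1/2) * ⟪B h, h⟫| ≤ ε * ‖h‖ ^ 2) ∧
      (∃ B : E →L[ℝ] E, ∀ ε > 0, ∃ r > 0, ∀ h : E, ‖h‖ < r →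
        |f₂ (x + h) - f₂ x - ⟪q₂ x, h⟫ - (1/2) * ⟪B h, h⟫| ≤ ε * ‖h‖ ^ 2) := by
  set F : E → ℝ := fun z => f₁ z + f₂ z - κ * ‖z‖ ^ 2 with hF
  have hc₁ := aux_cont hq₁ hL₁
  have hc₂ := aux_cont hq₂ hL₂
  have hmax : ∀ p : E, ∃ x, ∀ z, F z ≤ F x + ⟪p, z - x⟫ := by
    intro p
    obtain ⟨x, hx⟩ := aux_coercive_min (g := fun x => - F x + ⟪p, x⟫) (κ := κ)
      (L := 2 * L + ‖p‖) (C := f₁ 0 + f₂ 0) (by fun_prop) hκ (by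
        intro x
        have a1 := aux_lip hq₁ hL₁ x 0
        have a2 := aux_lip hq₂ hL₂ x 0
        rw [zero_sub, norm_neg] at a1 a2
        have h2 := abs_le.1 (abs_real_inner_le_norm p x)
        simp only [hF]
        nlinarith [h2.1])
    refine ⟨x, fun z => ?_⟩
    have := hx z
    rw [inner_sub_right]
    linarith
  have hlow : ∀ x z, F x + ⟪q₁ x + q₂ x - (2 * κ) • x, z - x⟫ - κ * ‖z - x‖ ^ 2 ≤ F z := by
    intro x z
    have a1 := hq₁ x z
    have a2 := hq₂ x z
    have e := aux_expand_sq x z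
    simp only [hF]
    rw [inner_sub_left, inner_add_left, inner_smul_left, conj_trivial, e]
    linarith
  have hp : ∀ x p, (∀ z, F z ≤ F x + ⟪p, z - x⟫) → q₁ x + q₂ x - (2 * κ) • x = p := by
    intro x p h
    apply sub_eq_zero.1
    apply aux_lin_zero (c := κ)
    intro v
    have a := h (x + v)
    have b := hlow x (x + v)
    rw [add_sub_cancel_left] at a b
    rw [inner_sub_left]
    linarith
  have h12 := (aux_alexandrov hq₁ hL₁).and (aux_alexandrov hq₂ hL₂)
  set ν : Measure E := μH[Module.finrank ℝ E] with hν
  rw [ae_iff] at h12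
  set Nn := {a | ¬ ((∃ B : E →L[ℝ] E, ∀ ε > 0, ∃ r > 0, ∀ h : E, ‖h‖ < r →
        |f₁ (a + h) - f₁ a - ⟪q₁ a, h⟫ - (1/2) * ⟪B h, h⟫| ≤ ε * ‖h‖ ^ 2) ∧
      (∃ B : E →L[ℝ] E, ∀ ε > 0, ∃ r > 0, ∀ h : E, ‖h‖ < r →
        |f₂ (a + h) - f₂ a - ⟪q₂ a, h⟫ - (1/2) * ⟪B h, h⟫| ≤ ε * ‖h‖ ^ 2))} with hNn
  set Q : E → E := fun x => q₁ x + q₂ x - (2 * κ) • x with hQ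
  set A : Set E := {x | ∀ z, F z ≤ F x + ⟪Q x, z - x⟫} with hA
  have hlip : LipschitzOnWith (⟨4 * κ, by positivity⟩ : ℝ≥0) Q A := by
    apply LipschitzOnWith.of_dist_le_mul
    intro x hx y hy
    rw [dist_eq_norm, dist_eq_norm]
    exact aux_contact_lip hκ hx hy (hlow x)
  have hnull : ν (Q '' (Nn ∩ A)) = 0 := by
    have := (hlip.mono inter_subset_right : LipschitzOnWith _ Q (Nn ∩ A)).hausdorffMeasure_image_le
      (d := Module.finrank ℝ E) (by positivity)
    rw [← hν, measure_mono_null inter_subset_left h12, mul_zero] at this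
    exact le_antisymm this (zero_le)
  have hpos : 0 < ν (Metric.ball 0 δ) := Metric.isOpen_ball.measure_pos ν ⟨0, by simpa using hδ⟩
  obtain ⟨p, hpδ, hpn⟩ : ∃ p ∈ Metric.ball (0:E) δ, p ∉ Q '' (Nn ∩ A) := by
    by_contra hcon
    push Not at hcon
    exact hpos.ne' (measure_mono_null hcon hnull)
  obtain ⟨x, hx⟩ := hmax p
  have hQx : Q x = p := hp x p hx
  have hxA : x ∈ A := by
    intro z; rw [hQx]; exact hx z
  have hxN : x ∉ Nn := fun h => hpn ⟨x, ⟨h, hxA⟩, hQx⟩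
  rw [hNn, mem_ofPred_eq, not_not] at hxN
  exact ⟨x, p, by simpa using hpδ, hx, hQx, hxN.1, hxN.2⟩

lemma aux_supconv {v : E → ℝ} {K : Set E} (hK : IsCompact K) (hne : K.Nonempty)
    (hv : UpperSemicontinuousOn v K) (κ : ℝ) :
    ∃ ζ : E → E, (∀ x, ζ x ∈ K) ∧
      ∀ x, ∀ y ∈ K, v y - κ * ‖x - y‖ ^ 2 ≤ v (ζ x) - κ * ‖x - ζ x‖ ^ 2 := by
  have : ∀ x : E, ∃ z ∈ K, ∀ y ∈ K, v y - κ * ‖x - y‖ ^ 2 ≤ v z - κ * ‖x - z‖ ^ 2 := by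
    intro x
    have hc : Continuous (fun y : E => - (κ * ‖x - y‖ ^ 2)) := by fun_prop
    obtain ⟨z, hz, h⟩ := UpperSemicontinuousOn.exists_isMaxOn hne hK
      (hv.add (hc.upperSemicontinuous.upperSemicontinuousOn K))
    refine ⟨z, hz, fun y hy => ?_⟩
    have := h hy
    simp only [mem_ofPred_eq] at this
    linarith
  choose ζ h1 h2 using this
  exact ⟨ζ, h1, h2⟩

lemma aux_sums {v₁ v₂ : E → ℝ} {K : Set E} (hK : IsCompact K) (hne : K.Nonempty)
    (hv₁ : UpperSemicontinuousOn v₁ K) (hv₂ : UpperSemicontinuousOn v₂ K)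
    {κ δ : ℝ} (hκ : 0 < κ) (hδ : 0 < δ) :
    ∃ (x z₁ z₂ : E) (X₁ X₂ : E →L[ℝ] E), z₁ ∈ K ∧ z₂ ∈ K ∧
      ‖(2 * κ) • (z₁ - x) + (2 * κ) • (z₂ - x)‖ < δ ∧
      (∀ h, ⟪X₁ h, h⟫ + ⟪X₂ h, h⟫ ≤ 0) ∧
      (∀ η > 0, ∃ r > 0, ∀ h, ‖h‖ < r → z₁ + h ∈ K →
        v₁ (z₁ + h) ≤ v₁ z₁ + ⟪(2 * κ) • (z₁ - x), h⟫ + (1/2) * ⟪X₁ h, h⟫ + η * ‖h‖ ^ 2) ∧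
      (∀ η > 0, ∃ r > 0, ∀ h, ‖h‖ < r → z₂ + h ∈ K →
        v₂ (z₂ + h) ≤ v₂ z₂ + ⟪(2 * κ) • (z₂ - x), h⟫ + (1/2) * ⟪X₂ h, h⟫ + η * ‖h‖ ^ 2) ∧
      (∀ y ∈ K, v₁ y + v₂ y - δ * ‖x - y‖ ≤
        v₁ z₁ + v₂ z₂ - κ * (‖x - z₁‖ ^ 2 + ‖x - z₂‖ ^ 2)) := by
  obtain ⟨ζ₁, hm₁, hz₁⟩ := aux_supconv hK hne hv₁ κ
  obtain ⟨ζ₂, hm₂, hz₂⟩ := aux_supconv hK hne hv₂ κ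
  obtain ⟨R, hR⟩ := hK.isBounded.exists_norm_le
  -- generic facts
  have sub : ∀ (v : E → ℝ) (ζ : E → E), (∀ x, ζ x ∈ K) →
      (∀ x, ∀ y ∈ K, v y - κ * ‖x - y‖ ^ 2 ≤ v (ζ x) - κ * ‖x - ζ x‖ ^ 2) →
      ∀ x z, (v (ζ x) - κ * ‖x - ζ x‖ ^ 2 + κ * ‖x‖ ^ 2) + ⟪(2 * κ) • ζ x, z - x⟫ ≤
        v (ζ z) - κ * ‖z - ζ z‖ ^ 2 + κ * ‖z‖ ^ 2 := by
    intro v ζ h1 h2 x z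
    have a := h2 z (ζ x) (h1 x)
    rw [norm_sub_sq_real z (ζ x)] at a
    rw [norm_sub_sq_real x (ζ x), inner_smul_left, conj_trivial, inner_sub_right,
      real_inner_comm z, real_inner_comm x]
    linarith
  have bd : ∀ (ζ : E → E), (∀ x, ζ x ∈ K) → ∀ x, ‖(2 * κ) • ζ x‖ ≤ 2 * κ * R := by
    intro ζ h x
    rw [norm_smul, Real.norm_eq_abs, abs_of_pos (by positivity)]
    gcongr
    exact hR _ (h x)
  have up : ∀ (v : E → ℝ) (ζ : E → E), (∀ x, ζ x ∈ K) →
      (∀ x, ∀ y ∈ K, v y - κ * ‖x - y‖ ^ 2 ≤ v (ζ x) - κ * ‖x - ζ x‖ ^ 2) →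
      ∀ x (B : E →L[ℝ] E), (∀ ε > 0, ∃ r > 0, ∀ h : E, ‖h‖ < r →
        |(v (ζ (x + h)) - κ * ‖(x + h) - ζ (x + h)‖ ^ 2 + κ * ‖x + h‖ ^ 2) -
          (v (ζ x) - κ * ‖x - ζ x‖ ^ 2 + κ * ‖x‖ ^ 2) - ⟪(2 * κ) • ζ x, h⟫ -
          (1/2) * ⟪B h, h⟫| ≤ ε * ‖h‖ ^ 2) →
      (∀ η > 0, ∃ r > 0, ∀ h, ‖h‖ < r → ζ x + h ∈ K →
        v (ζ x + h) ≤ v (ζ x) + ⟪(2 * κ) • (ζ x - x), h⟫ +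
          (1/2) * ⟪(B - (2 * κ) • ContinuousLinearMap.id ℝ E) h, h⟫ + η * ‖h‖ ^ 2) := by
    intro v ζ h1 h2 x B hB η hη
    obtain ⟨r, hr, H⟩ := hB η hη
    refine ⟨r, hr, fun h hh hmem => ?_⟩
    have a := (abs_le.1 (H h hh)).2
    have b := h2 (x + h) (ζ x + h) hmem
    rw [add_sub_add_right_eq_sub] at b
    have e : ⟪(B - (2 * κ) • ContinuousLinearMap.id ℝ E) h, h⟫ = ⟪B h, h⟫ - 2 * κ * ‖h‖ ^ 2 := by
      simp [inner_sub_left, inner_smul_left]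
    rw [e, smul_sub, inner_sub_left, inner_smul_left (𝕜 := ℝ) x, conj_trivial]
    have e2 := norm_add_sq_real x h
    rw [e2] at a
    linarith
  obtain ⟨x, p, hpδ, hmax, hpe, ⟨B₁, hB₁⟩, ⟨B₂, hB₂⟩⟩ :=
    aux_jensen (κ := 2 * κ) (by positivity) hδ (sub v₁ ζ₁ hm₁ hz₁) (bd ζ₁ hm₁)
      (sub v₂ ζ₂ hm₂ hz₂) (bd ζ₂ hm₂)
  refine ⟨x, ζ₁ x, ζ₂ x, B₁ - (2 * κ) • ContinuousLinearMap.id ℝ E,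
    B₂ - (2 * κ) • ContinuousLinearMap.id ℝ E, hm₁ x, hm₂ x, ?_, ?_,
    up v₁ ζ₁ hm₁ hz₁ x B₁ hB₁, up v₂ ζ₂ hm₂ hz₂ x B₂ hB₂, ?_⟩
  · have : (2 * κ) • (ζ₁ x - x) + (2 * κ) • (ζ₂ x - x) = p := by
      rw [← hpe]; module
    rwa [this]
  · intro h
    have e : ∀ B : E →L[ℝ] E, ⟪(B - (2 * κ) • ContinuousLinearMap.id ℝ E) h, h⟫
        = ⟪B h, h⟫ - 2 * κ * ‖h‖ ^ 2 := by
      intro B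
      simp [inner_sub_left, inner_smul_left]
    rw [e, e]
    have key : ∀ η > 0, (1/2) * (⟪B₁ h, h⟫ - 2 * κ * ‖h‖ ^ 2 + (⟪B₂ h, h⟫ - 2 * κ * ‖h‖ ^ 2))
        ≤ 0 + η * (2 * ‖h‖ ^ 2) := by
      intro η hη
      obtain ⟨r₁, hr₁, H₁⟩ := hB₁ η hη
      obtain ⟨r₂, hr₂, H₂⟩ := hB₂ η hη
      obtain ⟨t, ht0, ht⟩ : ∃ t : ℝ, 0 < t ∧ t * ‖h‖ < min r₁ r₂ := by
        refine ⟨min r₁ r₂ / (2 * (‖h‖ + 1)), by positivity, ?_⟩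
        rw [div_mul_eq_mul_div, div_lt_iff₀ (by positivity)]
        have : 0 < min r₁ r₂ := by positivity
        nlinarith [norm_nonneg h]
      have hn : ‖t • h‖ = t * ‖h‖ := by rw [norm_smul, Real.norm_eq_abs, abs_of_pos ht0]
      have a₁ := (abs_le.1 (H₁ (t • h) (by rw [hn]; exact ht.trans_le (min_le_left _ _)))).1
      have a₂ := (abs_le.1 (H₂ (t • h) (by rw [hn]; exact ht.trans_le (min_le_right _ _)))).1
      have m := hmax (x + t • h)
      rw [← hpe, add_sub_cancel_left, norm_add_sq_real, inner_sub_left, inner_add_left,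
        inner_smul_left x, conj_trivial] at m
      have e4 : ∀ B : E →L[ℝ] E, ⟪B (t • h), t • h⟫ = t ^ 2 * ⟪B h, h⟫ := by
        intro B
        rw [map_smul, inner_smul_left, inner_smul_right, conj_trivial]; ring
      rw [e4, hn, norm_add_sq_real, hn] at a₁ a₂
      rw [hn] at m
      have : t ^ 2 * ((1/2) * (⟪B₁ h, h⟫ - 2 * κ * ‖h‖ ^ 2 + (⟪B₂ h, h⟫ - 2 * κ * ‖h‖ ^ 2)))
        ≤ t ^ 2 * (0 + η * (2 * ‖h‖ ^ 2)) := by linarith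
      exact le_of_mul_le_mul_left this (by positivity)
    have : (1/2) * (⟪B₁ h, h⟫ - 2 * κ * ‖h‖ ^ 2 + (⟪B₂ h, h⟫ - 2 * κ * ‖h‖ ^ 2)) ≤ 0 := by
      apply le_of_forall_pos_le_add
      intro η hη
      have := key (η / (2 * ‖h‖ ^ 2 + 1)) (by positivity)
      refine this.trans ?_
      have : η / (2 * ‖h‖ ^ 2 + 1) * (2 * ‖h‖ ^ 2) ≤ η := by
        rw [div_mul_eq_mul_div, div_le_iff₀ (by positivity)]
        nlinarith
      linarith
    linarith
  · intro y hy
    have m := hmax y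
    have a₁ := hz₁ y y hy
    have a₂ := hz₂ y y hy
    simp only [sub_self, norm_zero] at a₁ a₂
    have c := (abs_le.1 (abs_real_inner_le_norm p (y - x))).2
    rw [norm_sub_rev y x] at c
    have := mul_le_mul_of_nonneg_right hpδ.le (norm_nonneg (x - y))
    linarith

end Alexandrov

section Testing

open scoped RealInnerProductSpace

/-- quadratic test function -/
noncomputable def quadT {N : ℕ} (a z : EuclideanSpace ℝ (Fin N))
    (X : EuclideanSpace ℝ (Fin N) →L[ℝ] EuclideanSpace ℝ (Fin N))
    (x : EuclideanSpace ℝ (Fin N)) : ℝ :=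
  ⟪a, x - z⟫ + (1/2) * ⟪X (x - z), x - z⟫

variable {N : ℕ} (a z : EuclideanSpace ℝ (Fin N))
    (X : EuclideanSpace ℝ (Fin N) →L[ℝ] EuclideanSpace ℝ (Fin N))

lemma quadT_contDiff : ContDiff ℝ 2 (quadT a z X) := by
  unfold quadT
  have h : ContDiff ℝ 2 (fun x : EuclideanSpace ℝ (Fin N) => x - z) :=
    contDiff_id.sub contDiff_const
  exact ContDiff.add (contDiff_const.inner ℝ h)
    (contDiff_const.mul ((X.contDiff.comp h).inner ℝ h))

lemma quadT_fderiv (x w : EuclideanSpace ℝ (Fin N)) :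
    fderiv ℝ (quadT a z X) x w = ⟪a, w⟫ + (1/2) * (⟪X (x - z), w⟫ + ⟪X w, x - z⟫) := by
  have h0 : HasFDerivAt (fun x : EuclideanSpace ℝ (Fin N) => x - z)
      (ContinuousLinearMap.id ℝ _) x := (hasFDerivAt_id x).sub_const z
  have h1 : HasFDerivAt (fun x : EuclideanSpace ℝ (Fin N) => X (x - z)) (X.comp
      (ContinuousLinearMap.id ℝ _)) x := X.hasFDerivAt.comp x h0
  have h2 := ((hasFDerivAt_const a x).inner ℝ h0).add ((h1.inner ℝ h0).const_mul (1/2))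
  have h3 : HasFDerivAt (quadT a z X) _ x := h2
  rw [h3.fderiv]
  simp [fderivInnerCLM_apply]

lemma quadT_gradient : gradient (quadT a z X) z = a := by
  have hd : DifferentiableAt ℝ (quadT a z X) z :=
    (quadT_contDiff a z X).differentiable (by norm_num) z
  apply ext_inner_right ℝ
  intro w
  have : ⟪gradient (quadT a z X) z, w⟫ = fderiv ℝ (quadT a z X) z w := by
    simp [gradient]
  rw [this, quadT_fderiv]
  simp

lemma quadT_hess (ξ : EuclideanSpace ℝ (Fin N)) :
    iteratedFDeriv ℝ 2 (quadT a z X) z ![ξ, ξ] = ⟪X ξ, ξ⟫ := by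
  rw [iteratedFDeriv_two_apply]
  have hd : DifferentiableAt ℝ (fderiv ℝ (quadT a z X)) z :=
    ((quadT_contDiff a z X).fderiv_right (m := 1) (by norm_num)).differentiable (by norm_num) z
  have h1 := hd.hasFDerivAt.clm_apply (hasFDerivAt_const ξ z)
  have e : (fun y => fderiv ℝ (quadT a z X) y ξ)
      = fun x => ⟪a, ξ⟫ + (1/2) * (⟪X (x - z), ξ⟫ + ⟪X ξ, x - z⟫) := by
    funext x; exact quadT_fderiv a z X x ξ
  rw [e] at h1
  have h0 : HasFDerivAt (fun x : EuclideanSpace ℝ (Fin N) => x - z)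
      (ContinuousLinearMap.id ℝ _) z := (hasFDerivAt_id z).sub_const z
  have h2 : HasFDerivAt (fun x : EuclideanSpace ℝ (Fin N) => X (x - z)) (X.comp
      (ContinuousLinearMap.id ℝ _)) z := X.hasFDerivAt.comp z h0
  have h3 := (((h2.inner ℝ (hasFDerivAt_const ξ z)).add
    ((hasFDerivAt_const (X ξ) z).inner ℝ h0)).const_mul (1/2)).const_add ⟪a, ξ⟫
  have h4 := congrArg (fun T => T ξ) (h1.unique h3)
  simp [fderivInnerCLM_apply] at h4
  simp
  rw [h4]; ring

lemma frames_bdd (k : ℕ) : BddBelow {s : ℝ | ∃ ξ : Fin k → EuclideanSpace ℝ (Fin N),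
    Orthonormal ℝ ξ ∧ s = ∑ i, iteratedFDeriv ℝ 2 (quadT a z X) z ![ξ i, ξ i]} := by
  refine ⟨∑ i : Fin k, - ‖X‖, ?_⟩
  rintro s ⟨ξ, hξ, rfl⟩
  apply Finset.sum_le_sum
  intro i _
  rw [quadT_hess]
  have h1 := (abs_le.1 (abs_real_inner_le_norm (X (ξ i)) (ξ i))).1
  have h2 := X.le_opNorm (ξ i)
  rw [hξ.1 i] at h1 h2
  linarith

lemma frames_nonempty {k : ℕ} (hk : k ≤ N) :
    ∃ ξ : Fin k → EuclideanSpace ℝ (Fin N), Orthonormal ℝ ξ := by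
  refine ⟨fun i => EuclideanSpace.basisFun (Fin N) ℝ (Fin.castLE hk i), ?_⟩
  exact (EuclideanSpace.basisFun (Fin N) ℝ).orthonormal.comp _ (Fin.castLE_injective hk)

lemma quadT_id_add (η : ℝ) (ξ : EuclideanSpace ℝ (Fin N)) :
    ⟪(X + (2 * η) • ContinuousLinearMap.id ℝ (EuclideanSpace ℝ (Fin N))) ξ, ξ⟫ = ⟪X ξ, ξ⟫ + 2 * η * ‖ξ‖ ^ 2 := by
  simp [inner_add_left, inner_smul_left]

lemma sub_test {k : ℕ} {Ω : Set (EuclideanSpace ℝ (Fin N))}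
    {H : EuclideanSpace ℝ (Fin N) → EuclideanSpace ℝ (Fin N) → ℝ} {μ : ℝ}
    {u : EuclideanSpace ℝ (Fin N) → ℝ} (hsub : IsViscSubsol (Pminus k) Ω H μ (fun _ => 0) u)
    {K : Set (EuclideanSpace ℝ (Fin N))} {z a : EuclideanSpace ℝ (Fin N)}
    (hz : z ∈ Ω) (hzK : z ∈ interior K)
    {X : EuclideanSpace ℝ (Fin N) →L[ℝ] EuclideanSpace ℝ (Fin N)}
    (hexp : ∀ η > 0, ∃ r > 0, ∀ h, ‖h‖ < r → z + h ∈ K →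
        u (z + h) ≤ u z + ⟪a, h⟫ + (1/2) * ⟪X h, h⟫ + η * ‖h‖ ^ 2)
    (ξ : Fin k → EuclideanSpace ℝ (Fin N)) (hξ : Orthonormal ℝ ξ) :
    0 ≤ ∑ i, ⟪X (ξ i), ξ i⟫ + H z a + μ * u z := by
  have key : ∀ η > 0, 0 ≤ ∑ i, ⟪X (ξ i), ξ i⟫ + H z a + μ * u z + η * (2 * k) := by
    intro η hη
    obtain ⟨r, hr, hr'⟩ := hexp η hη
    set X' := X + (2 * η) • ContinuousLinearMap.id ℝ (EuclideanSpace ℝ (Fin N)) with hX'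
    have hmax : IsLocalMaxOn (fun x => u x - quadT a z X' x) Ω z := by
      apply IsLocalMax.on
      filter_upwards [mem_interior_iff_mem_nhds.1 hzK, Metric.ball_mem_nhds z hr] with x hxK hxr
      have h1 := hr' (x - z) (by simpa [dist_eq_norm] using hxr) (by simpa using hxK)
      rw [add_sub_cancel] at h1
      simp only [quadT, hX']
      rw [quadT_id_add, quadT_id_add]
      simp only [sub_self, norm_zero, map_zero, inner_zero_right]
      linarith
    have h2 := hsub z hz _ ((quadT_contDiff a z X').contDiffAt) hmax
    rw [quadT_gradient] at h2
    have h3 : Pminus k (quadT a z X') z ≤ ∑ i, ⟪X (ξ i), ξ i⟫ + η * (2 * k) := by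
      refine (csInf_le (frames_bdd a z X' k) ⟨ξ, hξ, rfl⟩).trans (le_of_eq ?_)
      simp only [quadT_hess, hX', quadT_id_add, hξ.1]
      rw [Finset.sum_add_distrib]
      simp
      ring
    linarith
  by_contra hc
  push Not at hc
  set c := ∑ i, ⟪X (ξ i), ξ i⟫ + H z a + μ * u z with hcdef
  have h := key (-c / (2 * (2 * k + 1))) (by apply div_pos; linarith; positivity)
  have : -c / (2 * (2 * (k:ℝ) + 1)) * (2 * k) ≤ -c / 2 := by
    rw [div_mul_eq_mul_div, div_le_div_iff₀ (by positivity) (by norm_num)]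
    nlinarith [(Nat.cast_nonneg k : (0:ℝ) ≤ k)]
  linarith

lemma super_test {k : ℕ} (hk : k ≤ N) {Ω : Set (EuclideanSpace ℝ (Fin N))}
    {H : EuclideanSpace ℝ (Fin N) → EuclideanSpace ℝ (Fin N) → ℝ} {μ : ℝ}
    {w : EuclideanSpace ℝ (Fin N) → ℝ} (hsup : IsViscSupersol (Pminus k) Ω H μ (fun _ => 0) w)
    {K : Set (EuclideanSpace ℝ (Fin N))} {z a : EuclideanSpace ℝ (Fin N)}
    (hz : z ∈ Ω) (hzK : z ∈ interior K)
    {X : EuclideanSpace ℝ (Fin N) →L[ℝ] EuclideanSpace ℝ (Fin N)}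
    (hexp : ∀ η > 0, ∃ r > 0, ∀ h, ‖h‖ < r → z + h ∈ K →
        w z + ⟪a, h⟫ + (1/2) * ⟪X h, h⟫ - η * ‖h‖ ^ 2 ≤ w (z + h)) (ε : ℝ) (hε : 0 < ε) :
    ∃ ξ : Fin k → EuclideanSpace ℝ (Fin N), Orthonormal ℝ ξ ∧
      ∑ i, ⟪X (ξ i), ξ i⟫ + H z a + μ * w z ≤ ε := by
  set η := ε / (2 * (2 * k + 1)) with hη'
  have hη : 0 < η := by positivity
  obtain ⟨r, hr, hr'⟩ := hexp η hη
  set X' := X + (2 * (-η)) • ContinuousLinearMap.id ℝ (EuclideanSpace ℝ (Fin N)) with hX'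
  have hmin : IsLocalMinOn (fun x => w x - quadT a z X' x) Ω z := by
    apply IsLocalMin.on
    filter_upwards [mem_interior_iff_mem_nhds.1 hzK, Metric.ball_mem_nhds z hr] with x hxK hxr
    have h1 := hr' (x - z) (by simpa [dist_eq_norm] using hxr) (by simpa using hxK)
    rw [add_sub_cancel] at h1
    simp only [quadT, hX']
    rw [quadT_id_add, quadT_id_add]
    simp only [sub_self, norm_zero, map_zero, inner_zero_right]
    linarith
  have h2 := hsup z hz _ ((quadT_contDiff a z X').contDiffAt) hmin
  rw [quadT_gradient] at h2
  obtain ⟨ξ₀, hξ₀⟩ := frames_nonempty hk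
  obtain ⟨s, ⟨ξ, hξ, rfl⟩, hs⟩ := exists_lt_of_csInf_lt (b := Pminus k (quadT a z X') z + ε / 2)
    (s := {s : ℝ | ∃ ξ : Fin k → EuclideanSpace ℝ (Fin N),
      Orthonormal ℝ ξ ∧ s = ∑ i, iteratedFDeriv ℝ 2 (quadT a z X') z ![ξ i, ξ i]})
    ⟨_, ξ₀, hξ₀, rfl⟩ (by
      change Pminus k (quadT a z X') z < _
      linarith)
  refine ⟨ξ, hξ, ?_⟩
  simp only [quadT_hess, hX', quadT_id_add, hξ.1] at hs
  rw [Finset.sum_add_distrib] at hs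
  simp only [one_pow, mul_one, Finset.sum_const, Finset.card_univ, Fintype.card_fin,
    nsmul_eq_mul] at hs
  have : η * (2 * k) ≤ ε / 2 := by
    rw [hη', div_mul_eq_mul_div, div_le_div_iff₀ (by positivity) (by norm_num)]
    nlinarith
  rw [← hX'] at hs
  linarith

end Testing

section FinalPart

open scoped RealInnerProductSpace

lemma comparison_step {N : ℕ} {k : ℕ} (hkN : k ≤ N)
    {Ω : Set (EuclideanSpace ℝ (Fin N))}
    {H : EuclideanSpace ℝ (Fin N) → EuclideanSpace ℝ (Fin N) → ℝ}
    (hHcont : ContinuousOn (Function.uncurry H)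
      (Ω ×ˢ (univ : Set (EuclideanSpace ℝ (Fin N)))))
    (hSC2 : SC2 Ω H) {ω : ℝ → ℝ}
    (hω : ∀ x ∈ Ω, ∀ y ∈ Ω, ∀ ξ : EuclideanSpace ℝ (Fin N),
      |H x ξ - H y ξ| ≤ ω (‖x - y‖ * (1 + ‖ξ‖)))
    {μ μ' : ℝ} {u w : EuclideanSpace ℝ (Fin N) → ℝ}
    (hsub : IsViscSubsol (Pminus k) Ω H μ (fun _ => 0) u)
    (hsup : IsViscSupersol (Pminus k) Ω H μ' (fun _ => 0) w)
    {K : Set (EuclideanSpace ℝ (Fin N))} (hK : IsCompact K) (hKΩ : K ⊆ Ω)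
    (hu : UpperSemicontinuousOn u K) (hw : LowerSemicontinuousOn w K)
    {M R : ℝ} (hM : 0 < M) (hR : 0 ≤ R) (hKR : ∀ y ∈ K, ‖y‖ ≤ R)
    {x0 : EuclideanSpace ℝ (Fin N)} (hx0 : x0 ∈ K) (hux0 : u x0 = M * w x0)
    {κ τ : ℝ} (hκ : 1 ≤ κ) (hτ : 0 < τ) :
    ∃ (z₁ z₂ : EuclideanSpace ℝ (Fin N)) (s A : ℝ), z₁ ∈ K ∧ z₂ ∈ K ∧ 0 ≤ s ∧ 0 ≤ A ∧
      s ≤ u z₁ - M * w z₂ + τ ∧ κ * ‖z₁ - z₂‖ ^ 2 ≤ 2 * s ∧ ‖z₁ - z₂‖ * A ≤ 4 * s ∧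
      (z₁ ∈ interior K → z₂ ∈ interior K →
        0 ≤ ω (‖z₁ - z₂‖ * (1 + A)) + τ + μ * u z₁ - μ' * (M * w z₂)) := by
  have hκ0 : 0 < κ := by linarith
  set ρ := 2 * κ * (2 * R + 1) with hρ
  have hUC : UniformContinuousOn (Function.uncurry H) (K ×ˢ closedBall 0 ρ) :=
    (hK.prod (isCompact_closedBall _ _)).uniformContinuousOn_of_continuous
      (hHcont.mono (prod_mono hKΩ (subset_univ _)))
  rw [Metric.uniformContinuousOn_iff] at hUC
  obtain ⟨δ₁, hδ₁, hUC⟩ := hUC τ hτ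
  set δ := min δ₁ (min 1 (τ / (2 * R + 1))) with hδ
  have hδ0 : 0 < δ := by positivity
  have hδ1 : δ ≤ 1 := (min_le_right _ _).trans (min_le_left _ _)
  have hδτ : δ * (2 * R + 1) ≤ τ := by
    have : δ ≤ τ / (2 * R + 1) := (min_le_right _ _).trans (min_le_right _ _)
    rwa [le_div_iff₀ (by positivity)] at this
  have hv₂ : UpperSemicontinuousOn (fun x => - (M * w x)) K := by
    intro x hx y hy
    have hy' : -y < M * w x := by linarith
    have h1 : -y / M < w x := by rw [div_lt_iff₀ hM]; linarith
    filter_upwards [hw x hx _ h1] with x' hx'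
    rw [gt_iff_lt, div_lt_iff₀ hM] at hx'
    linarith
  obtain ⟨x, z₁, z₂, X₁, X₂, hz₁, hz₂, hp, hX, he₁, he₂, hmax⟩ :=
    aux_sums hK ⟨x0, hx0⟩ hu hv₂ hκ0 hδ0
  have hxn : ‖x‖ ≤ R + 1 := by
    have e : (2 * κ) • (z₁ - x) + (2 * κ) • (z₂ - x) = (2 * κ) • (z₁ + z₂ - (2:ℝ) • x) := by
      module
    rw [e, norm_smul, Real.norm_of_nonneg (by positivity)] at hp
    have h1 : ‖z₁ + z₂ - (2:ℝ) • x‖ ≤ 1 := by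
      nlinarith [norm_nonneg (z₁ + z₂ - (2:ℝ) • x)]
    have h2 : ‖(2:ℝ) • x‖ ≤ ‖z₁ + z₂‖ + ‖z₁ + z₂ - (2:ℝ) • x‖ := by
      have := norm_sub_le (z₁ + z₂) (z₁ + z₂ - (2:ℝ) • x)
      rwa [sub_sub_cancel] at this
    rw [norm_smul, Real.norm_of_nonneg (by norm_num)] at h2
    have h3 := norm_add_le z₁ z₂
    linarith [hKR z₁ hz₁, hKR z₂ hz₂]
  have hxy : ∀ y ∈ K, ‖x - y‖ ≤ 2 * R + 1 := by
    intro y hy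
    linarith [norm_sub_le x y, hKR y hy]
  have hm := hmax x0 hx0
  have hδx : δ * ‖x - x0‖ ≤ τ :=
    (mul_le_mul_of_nonneg_left (hxy x0 hx0) hδ0.le).trans hδτ
  set p := ‖x - z₁‖ with hpdef
  set q := ‖x - z₂‖ with hqdef
  have hp0 : 0 ≤ p := norm_nonneg _
  have hq0 : 0 ≤ q := norm_nonneg _
  have hpq : ‖z₁ - z₂‖ ≤ p + q := by
    have := norm_sub_le (x - z₂) (x - z₁)
    rw [sub_sub_sub_cancel_left] at this
    linarith
  have hd0 := norm_nonneg (z₁ - z₂)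
  have han : ‖(2 * κ) • (z₁ - x)‖ = 2 * κ * p := by
    rw [norm_smul, Real.norm_of_nonneg (by positivity), norm_sub_rev]
  have hbn : ‖-((2 * κ) • (z₂ - x))‖ = 2 * κ * q := by
    rw [norm_neg, norm_smul, Real.norm_of_nonneg (by positivity), norm_sub_rev]
  refine ⟨z₁, z₂, κ * (p ^ 2 + q ^ 2), 2 * κ * p, hz₁, hz₂, by positivity, by positivity,
    by linarith, ?_, ?_, ?_⟩
  · have : ‖z₁ - z₂‖ ^ 2 ≤ 2 * (p ^ 2 + q ^ 2) := by nlinarith [sq_nonneg (p - q)]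
    nlinarith
  · have : ‖z₁ - z₂‖ * p ≤ 2 * (p ^ 2 + q ^ 2) := by nlinarith [sq_nonneg (p - q)]
    nlinarith
  intro hi₁ hi₂
  set a := (2 * κ) • (z₁ - x) with ha
  set b := -((2 * κ) • (z₂ - x)) with hb
  have hHab : |H z₂ a - H z₂ b| ≤ τ := by
    have := hUC (z₂, a) ⟨hz₂, by
        rw [mem_closedBall_zero_iff, han]
        exact mul_le_mul_of_nonneg_left (hxy z₁ hz₁) (by positivity)⟩ (z₂, b) ⟨hz₂, by
        rw [mem_closedBall_zero_iff, hbn]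
        exact mul_le_mul_of_nonneg_left (hxy z₂ hz₂) (by positivity)⟩ (by
        rw [Prod.dist_eq]
        simp only [dist_self]
        rw [max_eq_right dist_nonneg, dist_eq_norm, hb, sub_neg_eq_add]
        exact hp.trans_le (min_le_left _ _))
    rw [Real.dist_eq] at this
    exact this.le
  have hHz := hω z₁ (hKΩ hz₁) z₂ (hKΩ hz₂) a
  rw [han] at hHz
  have hexp₂ : ∀ η > 0, ∃ r > 0, ∀ h, ‖h‖ < r → z₂ + h ∈ K →
      w z₂ + ⟪M⁻¹ • b, h⟫ + (1/2) * ⟪(-(M⁻¹ • X₂)) h, h⟫ - η * ‖h‖ ^ 2 ≤ w (z₂ + h) := by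
    intro η hη
    obtain ⟨r, hr, hr'⟩ := he₂ (M * η) (by positivity)
    refine ⟨r, hr, fun h hh hhK => ?_⟩
    have h1 := hr' h hh hhK
    have e1 : M * ⟪M⁻¹ • b, h⟫ = - ⟪(2 * κ) • (z₂ - x), h⟫ := by
      rw [inner_smul_left, hb, inner_neg_left]
      simp only [conj_trivial]
      field_simp
    have e2 : M * ⟪(-(M⁻¹ • X₂)) h, h⟫ = - ⟪X₂ h, h⟫ := by
      simp only [neg_apply, smul_apply, inner_neg_left,
        inner_smul_left, conj_trivial]
      field_simp
    refine le_of_mul_le_mul_left ?_ hM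
    linarith
  refine le_of_forall_pos_le_add fun ε hε => ?_
  obtain ⟨ξ, hξ, h2⟩ := super_test hkN hsup (hKΩ hz₂) hi₂ hexp₂ (M⁻¹ * ε) (by positivity)
  have h1 := sub_test hsub (hKΩ hz₁) hi₁ he₁ ξ hξ
  rw [hSC2 z₂ (hKΩ hz₂) M⁻¹ (by positivity) b] at h2
  have h3 := mul_le_mul_of_nonneg_left h2 hM.le
  have e3 : M * (∑ i, ⟪(-(M⁻¹ • X₂)) (ξ i), ξ i⟫ + M⁻¹ * H z₂ b + μ' * w z₂)
      = - ∑ i, ⟪X₂ (ξ i), ξ i⟫ + H z₂ b + μ' * (M * w z₂) := by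
    simp only [neg_apply, smul_apply, inner_neg_left,
        inner_smul_left, conj_trivial, Finset.sum_neg_distrib, ← Finset.mul_sum]
    field_simp
  rw [e3, mul_inv_cancel_left₀ hM.ne'] at h3
  have h4 : ∑ i, ⟪X₁ (ξ i), ξ i⟫ + ∑ i, ⟪X₂ (ξ i), ξ i⟫ ≤ 0 := by
    rw [← Finset.sum_add_distrib]
    exact Finset.sum_nonpos fun i _ => hX (ξ i)
  have h5 := (abs_le.1 hHab).2
  have h6 := (abs_le.1 hHz).2
  linarith

lemma comparison_limit {N : ℕ} {ω : ℝ → ℝ} (hωm : Monotone ω)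
    (hω0 : Tendsto ω (𝓝[>] (0 : ℝ)) (𝓝 (0 : ℝ)))
    {μ μ' : ℝ} (hμ : μ < μ') {u w : EuclideanSpace ℝ (Fin N) → ℝ}
    {K U : Set (EuclideanSpace ℝ (Fin N))} (hK : IsCompact K) (hUK : U ⊆ interior K)
    (hu : UpperSemicontinuousOn u K) (hw : LowerSemicontinuousOn w K)
    {M c : ℝ} (hM : 0 < M) (hc : 0 < c) (hwc : ∀ x ∈ K, c ≤ w x)
    (huw : ∀ x ∈ K, u x ≤ M * w x) (hU : ∀ x ∈ K, M * c ≤ u x → x ∈ U)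
    (hstep : ∀ n : ℕ, ∃ (z₁ z₂ : EuclideanSpace ℝ (Fin N)) (s A : ℝ), z₁ ∈ K ∧ z₂ ∈ K ∧ 0 ≤ s ∧
      0 ≤ A ∧ s ≤ u z₁ - M * w z₂ + 1 / ((n:ℝ) + 1) ∧ ((n:ℝ) + 1) * ‖z₁ - z₂‖ ^ 2 ≤ 2 * s ∧
      ‖z₁ - z₂‖ * A ≤ 4 * s ∧
      (z₁ ∈ interior K → z₂ ∈ interior K →
        0 ≤ ω (‖z₁ - z₂‖ * (1 + A)) + 1 / ((n:ℝ) + 1) + μ * u z₁ - μ' * (M * w z₂))) : False := by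
  choose z₁ z₂ s A hz₁ hz₂ hs hA h1 h2 h3 h4 using hstep
  have hτ : Tendsto (fun n : ℕ => 1 / ((n:ℝ) + 1)) atTop (𝓝 0) :=
    tendsto_one_div_add_atTop_nhds_zero_nat
  have hτ1 : ∀ n : ℕ, 1 / ((n:ℝ) + 1) ≤ 1 := by
    intro n
    rw [div_le_one (by positivity)]
    linarith [(Nat.cast_nonneg n : (0:ℝ) ≤ n)]
  obtain ⟨xm, hxm, hxm'⟩ := hu.exists_isMaxOn ⟨_, hz₁ 0⟩ hK
  have hub : ∀ y ∈ K, u y ≤ u xm := fun y hy => hxm' hy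
  have hsb : ∀ n, s n ≤ u xm + 1 := by
    intro n
    have := h1 n
    have h5 : 0 ≤ M * w (z₂ n) := mul_nonneg hM.le (hc.le.trans (hwc _ (hz₂ n)))
    linarith [hub _ (hz₁ n), hτ1 n]
  have hdd : Tendsto (fun n => z₁ n - z₂ n) atTop (𝓝 0) := by
    rw [tendsto_zero_iff_norm_tendsto_zero]
    have hsq : Tendsto (fun n => ‖z₁ n - z₂ n‖ ^ 2) atTop (𝓝 0) := by
      refine squeeze_zero (fun n => by positivity)
        (g := fun n : ℕ => 2 * (u xm + 1) * (1 / ((n:ℝ) + 1))) (fun n => ?_) ?_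
      · rw [mul_one_div, le_div_iff₀ (by positivity)]
        linarith [h2 n, hsb n]
      · simpa using hτ.const_mul (2 * (u xm + 1))
    have := hsq.sqrt
    simpa [Real.sqrt_sq (norm_nonneg _)] using this
  obtain ⟨zh, hzh, φ, hφ, hlim₁⟩ := hK.tendsto_subseq hz₁
  have hlim₂ : Tendsto (z₂ ∘ φ) atTop (𝓝 zh) := by
    have := hlim₁.sub (hdd.comp hφ.tendsto_atTop)
    simpa [Function.comp_def] using this
  have hτφ : Tendsto (fun n : ℕ => 1 / ((φ n:ℝ) + 1)) atTop (𝓝 0) := hτ.comp hφ.tendsto_atTop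
  have hK₁ : Tendsto (z₁ ∘ φ) atTop (𝓝[K] zh) :=
    tendsto_nhdsWithin_iff.2 ⟨hlim₁, Eventually.of_forall fun n => hz₁ _⟩
  have hK₂ : Tendsto (z₂ ∘ φ) atTop (𝓝[K] zh) :=
    tendsto_nhdsWithin_iff.2 ⟨hlim₂, Eventually.of_forall fun n => hz₂ _⟩
  -- semicontinuity
  have hev₁ : ∀ ε > 0, ∀ᶠ n in atTop, u (z₁ (φ n)) < u zh + ε := fun ε hε =>
    hK₁.eventually (hu zh hzh (u zh + ε) (by linarith))
  have hev₂ : ∀ ε > 0, ∀ᶠ n in atTop, M * w zh - ε < M * w (z₂ (φ n)) := by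
    intro ε hε
    have := hK₂.eventually (hw zh hzh (w zh - ε / M) (by linarith [div_pos hε hM]))
    filter_upwards [this] with n hn
    have h := mul_lt_mul_of_pos_left hn hM
    rw [mul_sub, mul_div_cancel₀ _ hM.ne'] at h
    exact h
  have huz : M * w zh ≤ u zh := by
    refine le_of_forall_pos_le_add fun ε hε => ?_
    obtain ⟨n, a1, a2, a3⟩ := ((hev₁ (ε/3) (by linarith)).and
      ((hev₂ (ε/3) (by linarith)).and (hτφ.eventually (gt_mem_nhds (by linarith : 0 < ε / 3))))).exists
    linarith [h1 (φ n), hs (φ n)]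
  have huz' := huw zh hzh
  have hzU : zh ∈ interior K := hUK (hU zh hzh
    ((mul_le_mul_of_nonneg_left (hwc zh hzh) hM.le).trans huz))
  have hin : interior K ∈ 𝓝 zh := isOpen_interior.mem_nhds hzU
  -- s → 0
  have hs0 : Tendsto (fun n => s (φ n)) atTop (𝓝 0) := by
    rw [tendsto_order]
    refine ⟨fun a ha => Eventually.of_forall fun n => ha.trans_le (hs _), fun ε hε => ?_⟩
    filter_upwards [hev₁ (ε/3) (by linarith), hev₂ (ε/3) (by linarith),
      hτφ.eventually (gt_mem_nhds (by linarith : 0 < ε / 3))] with n a1 a2 a3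
    linarith [h1 (φ n)]
  have hg0 : Tendsto (fun n => u (z₁ (φ n)) - M * w (z₂ (φ n))) atTop (𝓝 0) := by
    rw [tendsto_order]
    constructor
    · intro a ha
      filter_upwards [hτφ.eventually (gt_mem_nhds (by linarith : 0 < -a))] with n a3
      linarith [h1 (φ n), hs (φ n)]
    · intro ε hε
      filter_upwards [hev₁ (ε/3) (by linarith), hev₂ (ε/3) (by linarith)] with n a1 a2
      linarith
  have ht : Tendsto (fun n => (‖z₁ (φ n) - z₂ (φ n)‖ + 4 * s (φ n)) + 1 / ((φ n:ℝ) + 1)) atTop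
      (𝓝[>] 0) := by
    refine tendsto_nhdsWithin_iff.2 ⟨?_, Eventually.of_forall fun n => ?_⟩
    · have := (((hdd.comp hφ.tendsto_atTop).norm).add (hs0.const_mul 4)).add hτφ
      simpa [Function.comp_def] using this
    · have := hs (φ n)
      rw [mem_Ioi]
      positivity
  have hωt := hω0.comp ht
  have hfin : Tendsto (fun n => ω ((‖z₁ (φ n) - z₂ (φ n)‖ + 4 * s (φ n)) + 1 / ((φ n:ℝ) + 1))
      + 1 / ((φ n:ℝ) + 1) + |μ| * |u (z₁ (φ n)) - M * w (z₂ (φ n))|) atTop (𝓝 0) := by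
    have := (hωt.add hτφ).add (hg0.abs.const_mul |μ|)
    simpa [Function.comp_def] using this
  have hpos : 0 < (μ' - μ) * (M * c) := mul_pos (by linarith) (mul_pos hM hc)
  obtain ⟨n, b1, b2, b3⟩ := ((hfin.eventually (gt_mem_nhds hpos)).and
    ((hlim₁.eventually hin).and (hlim₂.eventually hin))).exists
  have h5 := h4 (φ n) b2 b3
  have h6 : ω (‖z₁ (φ n) - z₂ (φ n)‖ * (1 + A (φ n))) ≤
      ω ((‖z₁ (φ n) - z₂ (φ n)‖ + 4 * s (φ n)) + 1 / ((φ n:ℝ) + 1)) := by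
    apply hωm
    have : 0 < 1 / ((φ n:ℝ) + 1) := by positivity
    linarith [h3 (φ n)]
  have h7 : μ * (u (z₁ (φ n)) - M * w (z₂ (φ n))) ≤ |μ| * |u (z₁ (φ n)) - M * w (z₂ (φ n))| := by
    rw [← abs_mul]; exact le_abs_self _
  have h8 : (μ' - μ) * (M * c) ≤ (μ' - μ) * (M * w (z₂ (φ n))) :=
    mul_le_mul_of_nonneg_left (mul_le_mul_of_nonneg_left (hwc _ (hz₂ _)) hM.le) (by linarith)
  linarith

end FinalPart

/-- the weak maximum principle holds for
`𝒫⁻ₖ(D²·) + H(x,∇·) + μ·` in a bounded open set whenever `μ < μ̄ₖ⁺(Ω)`. -/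
theorem statement9 {N : ℕ} (hN : 2 ≤ N) (k : ℕ) (hk1 : 1 ≤ k) (hkN : k < N)
    (Ω : Set (EuclideanSpace ℝ (Fin N))) (hΩopen : IsOpen Ω)
    (hΩbdd : Bornology.IsBounded Ω)
    (H : EuclideanSpace ℝ (Fin N) → EuclideanSpace ℝ (Fin N) → ℝ)
    (hHcont : ContinuousOn (Function.uncurry H)
      (Ω ×ˢ (univ : Set (EuclideanSpace ℝ (Fin N)))))
    (hSC2 : SC2 Ω H) (hSC3 : SC3 Ω H)
    (μ : ℝ) (hμ : (μ : EReal) < muBarPlus k Ω H)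
    (u : EuclideanSpace ℝ (Fin N) → ℝ)
    (hu : UpperSemicontinuousOn u Ω)
    (hsub : IsViscSubsol (Pminus k) Ω H μ (fun _ => 0) u)
    (hbdry : ∀ z ∈ frontier Ω, ∀ ε > 0, ∀ᶠ x in 𝓝[Ω] z, u x < ε) :
    ∀ x ∈ Ω, u x ≤ 0 := by
  intro x1 hx1
  by_contra hpos
  push Not at hpos
  obtain ⟨m, ⟨μ', rfl, w, hw, hwpos, hsup⟩, hμμ'⟩ := lt_sSup_iff.1 hμ
  have hμμ' : μ < μ' := EReal.coe_lt_coe_iff.1 hμμ'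
  obtain ⟨ω, hωm, hω0, hω⟩ := hSC3
  have hcl : IsCompact (closure Ω) := hΩbdd.isCompact_closure
  have hΩcl : Ω ⊆ closure Ω := subset_closure
  obtain ⟨xm, hxm, hxm'⟩ := hw.exists_isMinOn ⟨x1, hΩcl hx1⟩ hcl
  have hwc : ∀ y ∈ closure Ω, w xm ≤ w y := fun y hy => hxm' hy
  have hc : 0 < w xm := hwpos xm hxm
  set c := w xm with hcdef
  have hw1 : 0 < w x1 := hwpos x1 (hΩcl hx1)
  set a := u x1 * c / w x1 with ha
  have ha0 : 0 < a := by positivity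
  have hau : a ≤ u x1 := by
    rw [ha, div_le_iff₀ hw1]
    exact mul_le_mul_of_nonneg_left (hwc x1 (hΩcl hx1)) hpos.le
  set U := {x | x ∈ Ω ∧ a ≤ u x} with hUdef
  have hUΩ : U ⊆ Ω := fun x hx => hx.1
  have hx1U : x1 ∈ U := ⟨hx1, hau⟩
  have hUclosed : IsClosed U := by
    apply isClosed_of_closure_subset
    intro x hx
    have hfr : ∃ᶠ y in 𝓝 x, y ∈ U := mem_closure_iff_frequently.1 hx
    have hno : ¬ ∀ᶠ y in 𝓝[Ω] x, u y < a := by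
      intro hev
      rw [eventually_nhdsWithin_iff] at hev
      obtain ⟨y, hy, hy'⟩ := (hfr.and_eventually hev).exists
      exact absurd (hy' hy.1) (not_lt.2 hy.2)
    by_cases hxΩ : x ∈ Ω
    · refine ⟨hxΩ, ?_⟩
      by_contra hlt
      exact hno (hu x hxΩ a (not_le.1 hlt))
    · exact absurd (hbdry x ⟨closure_mono hUΩ hx, by rwa [hΩopen.interior_eq]⟩ a ha0) hno
  have hUc : IsCompact U :=
    hcl.of_isClosed_subset hUclosed (hUΩ.trans hΩcl)
  have husc : UpperSemicontinuousOn (fun x => u x / w x) U := by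
    intro x hx y hy
    have hwx : 0 < w x := hwpos x (hΩcl hx.1)
    have hux : 0 < u x := ha0.trans_le hx.2
    have hy0 : 0 < y := (div_pos hux hwx).trans hy
    have hy1 : u x < y * w x := by rwa [div_lt_iff₀ hwx] at hy
    obtain ⟨m, hm1, hm2⟩ := exists_between hy1
    have e1 := (hu.mono hUΩ) x hx m hm1
    have e2 := (hw.mono (hUΩ.trans hΩcl)) x hx (m / y) (by
      change m / y < w x
      rw [div_lt_iff₀ hy0]; linarith)
    filter_upwards [e1, e2, self_mem_nhdsWithin] with x' h1 h2 h3
    have hwx' : 0 < w x' := hwpos x' (hΩcl h3.1)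
    rw [div_lt_iff₀ hwx']
    rw [gt_iff_lt, div_lt_iff₀ hy0] at h2
    linarith
  obtain ⟨x0, hx0, hx0'⟩ := husc.exists_isMaxOn ⟨x1, hx1U⟩ hUc
  set M := u x0 / w x0 with hMdef
  have hMmax : ∀ y ∈ U, u y / w y ≤ M := fun y hy => hx0' hy
  have hM1 : u x1 / w x1 ≤ M := hMmax x1 hx1U
  have hM : 0 < M := (div_pos hpos hw1).trans_le hM1
  have hMc : a ≤ M * c := by
    have : a = u x1 / w x1 * c := by rw [ha]; ring
    rw [this]
    exact mul_le_mul_of_nonneg_right hM1 hc.le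
  have huw : ∀ x ∈ Ω, u x ≤ M * w x := by
    intro x hx
    by_cases h : a ≤ u x
    · have := hMmax x ⟨hx, h⟩
      rwa [div_le_iff₀ (hwpos x (hΩcl hx))] at this
    · have := mul_le_mul_of_nonneg_left (hwc x (hΩcl hx)) hM.le
      linarith [not_le.1 h]
  have hux0 : u x0 = M * w x0 := by
    rw [hMdef, div_mul_cancel₀ _ (hwpos x0 (hΩcl hx0.1)).ne']
  obtain ⟨K, hK, hUK, hKΩ⟩ := exists_compact_between hUc hΩopen hUΩ
  obtain ⟨R, hR⟩ := hK.isBounded.exists_norm_le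
  have hx0K : x0 ∈ K := interior_subset (hUK hx0)
  have hR0 : 0 ≤ R := (norm_nonneg _).trans (hR x0 hx0K)
  have huK := hu.mono hKΩ
  have hwK := hw.mono (hKΩ.trans hΩcl)
  refine comparison_limit hωm hω0 hμμ' hK hUK huK hwK hM hc
    (fun x hx => hwc x (hΩcl (hKΩ hx))) (fun x hx => huw x (hKΩ hx))
    (fun x hx h => ⟨hKΩ hx, hMc.trans h⟩) (fun n => ?_)
  exact comparison_step hkN.le hHcont hSC2 hω hsub hsup hK hKΩ huK hwK hM hR0 hR hx0K hux0
    (by linarith [(Nat.cast_nonneg n : (0:ℝ) ≤ n)]) (by positivity)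
end

section
/- Let N ≥ 2, 1 ≤ k < N, let Ω ⊂ ℝ^N be a bounded open set, and let H : Ω × ℝ^N → ℝ be continuous and satisfy (SC2) and (SC3); set b = sup{|H(x,ξ)| : x ∈ Ω, |ξ| ≤ 1}. Then μ̄ₖ⁻(Ω) is finite. Moreover, if Ω ∈ 𝒞_R for some R > 0 with bR < k, then there exists a lower semicontinuous function v : cl(Ω) → ℝ with v ≤ 0 on cl(Ω), v not identically 0, v = 0 on ∂Ω, that is a viscosity supersolution of 𝒫⁻ₖ(D²v) + H(x,∇v) + μ̄ₖ⁻(Ω) v = 0 in Ω. -/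
open Metric Filter Topology Set

section Basics

variable {N : ℕ}

/-- Euclidean space. -/
abbrev Eu (N : ℕ) := EuclideanSpace ℝ (Fin N)

/-- Hessian quadratic form. -/
noncomputable def Hess (φ : Eu N → ℝ) (x v : Eu N) : ℝ := fderiv ℝ (fderiv ℝ φ) x v v

lemma Pminus_eq (k : ℕ) (φ : Eu N → ℝ) (x : Eu N) : Pminus k φ x =
    sInf {s : ℝ | ∃ ξ : Fin k → Eu N, Orthonormal ℝ ξ ∧ s = ∑ i, Hess φ x (ξ i)} := by
  simp only [Pminus, Hess, iteratedFDeriv_two_apply]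
  rfl

lemma Hess_abs_le (φ : Eu N → ℝ) (x v : Eu N) :
    |Hess φ x v| ≤ ‖fderiv ℝ (fderiv ℝ φ) x‖ * ‖v‖ ^ 2 := by
  have h := (fderiv ℝ (fderiv ℝ φ) x).le_opNorm₂ v v
  rw [Real.norm_eq_abs] at h
  unfold Hess
  nlinarith [h]

lemma Pminus_le (k : ℕ) (φ : Eu N → ℝ) (x : Eu N) (ξ : Fin k → Eu N) (hξ : Orthonormal ℝ ξ) :
    Pminus k φ x ≤ ∑ i, Hess φ x (ξ i) := by
  rw [Pminus_eq]
  refine csInf_le ⟨∑ _i : Fin k, -‖fderiv ℝ (fderiv ℝ φ) x‖, ?_⟩ ⟨ξ, hξ, rfl⟩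
  rintro s ⟨ζ, hζ, rfl⟩
  refine Finset.sum_le_sum fun i _ => ?_
  have := Hess_abs_le φ x (ζ i)
  rw [hζ.1 i] at this
  have := neg_le_of_abs_le this
  linarith

lemma exists_frame (k : ℕ) (hk : k ≤ N) : ∃ ξ : Fin k → Eu N, Orthonormal ℝ ξ :=
  ⟨fun i => EuclideanSpace.basisFun (Fin N) ℝ (Fin.castLE hk i),
    (EuclideanSpace.basisFun (Fin N) ℝ).orthonormal.comp _ (Fin.castLE_injective hk)⟩

lemma le_Pminus (k : ℕ) (hk : k ≤ N) (φ : Eu N → ℝ) (x : Eu N) (c : ℝ)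
    (h : ∀ ξ : Fin k → Eu N, Orthonormal ℝ ξ → c ≤ ∑ i, Hess φ x (ξ i)) : c ≤ Pminus k φ x := by
  rw [Pminus_eq]
  obtain ⟨ξ, hξ⟩ := exists_frame (N := N) k hk
  refine le_csInf ⟨_, ξ, hξ, rfl⟩ ?_
  rintro s ⟨ζ, hζ, rfl⟩
  exact h ζ hζ

lemma Pminus_comp (k : ℕ) (hk : k ≤ N) (φ ψ : Eu N → ℝ) (x y : Eu N) (c : ℝ)
    (h : ∀ v, Hess φ x v ≤ Hess ψ y v + c * ‖v‖ ^ 2) :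
    Pminus k φ x ≤ Pminus k ψ y + k * c := by
  rw [← sub_le_iff_le_add]
  refine le_Pminus k hk _ _ _ fun ξ hξ => ?_
  rw [sub_le_iff_le_add]
  refine (Pminus_le k φ x ξ hξ).trans ?_
  calc ∑ i, Hess φ x (ξ i) ≤ ∑ i, (Hess ψ y (ξ i) + c) := by
        refine Finset.sum_le_sum fun i _ => ?_
        have := h (ξ i)
        rwa [hξ.1 i, one_pow, mul_one] at this
    _ = _ := by simp [Finset.sum_add_distrib]

lemma fderiv_diff {φ : Eu N → ℝ} {x : Eu N} (h : ContDiffAt ℝ 2 φ x) :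
    DifferentiableAt ℝ (fderiv ℝ φ) x :=
  (h.fderiv_right (m := 1) (by norm_num)).differentiableAt (by norm_num)

lemma ev_diff {φ : Eu N → ℝ} {x : Eu N} (h : ContDiffAt ℝ 2 φ x) :
    ∀ᶠ y in 𝓝 x, DifferentiableAt ℝ φ y := by
  filter_upwards [h.eventually (by simp)] with y hy
  exact hy.differentiableAt (by norm_num)

lemma Hess_add {φ χ : Eu N → ℝ} {x : Eu N} (h : ContDiffAt ℝ 2 φ x) (h' : ContDiffAt ℝ 2 χ x)
    (v : Eu N) : Hess (fun y => φ y + χ y) x v = Hess φ x v + Hess χ x v := by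
  have : fderiv ℝ (fun y => φ y + χ y) =ᶠ[𝓝 x] fun y => fderiv ℝ φ y + fderiv ℝ χ y := by
    filter_upwards [ev_diff h, ev_diff h'] with y h1 h2
    exact fderiv_fun_add h1 h2
  unfold Hess
  rw [this.fderiv_eq, fderiv_fun_add (fderiv_diff h) (fderiv_diff h')]
  rfl

lemma grad_add {φ χ : Eu N → ℝ} {x : Eu N} (h : ContDiffAt ℝ 2 φ x) (h' : ContDiffAt ℝ 2 χ x) :
    gradient (fun y => φ y + χ y) x = gradient φ x + gradient χ x := by
  unfold gradient
  rw [fderiv_fun_add (ev_diff h).self_of_nhds (ev_diff h').self_of_nhds, map_add]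

lemma Hess_neg (φ : Eu N → ℝ) (x v : Eu N) : Hess (fun y => -φ y) x v = -Hess φ x v := by
  unfold Hess
  have : fderiv ℝ (fun y => -φ y) = fun y => -fderiv ℝ φ y := by
    ext1 y; exact fderiv_fun_neg
  rw [this, fderiv_fun_neg]; rfl

lemma grad_neg (φ : Eu N → ℝ) (x : Eu N) : gradient (fun y => -φ y) x = -gradient φ x := by
  unfold gradient
  rw [fderiv_fun_neg, map_neg]

lemma Hess_const_mul {φ : Eu N → ℝ} {x : Eu N} (h : ContDiffAt ℝ 2 φ x) (c : ℝ) (v : Eu N) :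
    Hess (fun y => c * φ y) x v = c * Hess φ x v := by
  have : fderiv ℝ (fun y => c * φ y) =ᶠ[𝓝 x] fun y => c • fderiv ℝ φ y := by
    filter_upwards [ev_diff h] with y h1
    exact fderiv_const_mul h1 c
  unfold Hess
  rw [this.fderiv_eq, fderiv_fun_const_smul (fderiv_diff h)]
  rfl

lemma grad_const_mul {φ : Eu N → ℝ} {x : Eu N} (h : ContDiffAt ℝ 2 φ x) (c : ℝ) :
    gradient (fun y => c * φ y) x = c • gradient φ x := by
  unfold gradient
  rw [fderiv_const_mul (ev_diff h).self_of_nhds]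
  simp

lemma Hess_const (c : ℝ) (x v : Eu N) : Hess (fun _ => c) x v = 0 := by
  unfold Hess
  simp

lemma grad_const (c : ℝ) (x : Eu N) : gradient (fun _ : Eu N => c) x = 0 := by
  unfold gradient
  simp

/-- squared distance -/
lemma contDiff_q (x₀ : Eu N) : ContDiff ℝ 2 (fun y : Eu N => ‖y - x₀‖ ^ 2) :=
  (contDiff_id.sub contDiff_const).norm_sq ℝ

lemma fderiv_q (x₀ : Eu N) : fderiv ℝ (fun y : Eu N => ‖y - x₀‖ ^ 2) =
    fun y => (2 : ℝ) • innerSL ℝ (y - x₀) := by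
  ext1 y
  have h := (hasStrictFDerivAt_norm_sq (y - x₀)).hasFDerivAt.comp y
    ((hasFDerivAt_id y).sub_const x₀)
  have h2 := h.fderiv
  simp only [Function.comp_def, id] at h2
  rw [h2]
  ext v
  simp

lemma Hess_q (x₀ x v : Eu N) : Hess (fun y : Eu N => ‖y - x₀‖ ^ 2) x v = 2 * ‖v‖ ^ 2 := by
  unfold Hess
  rw [fderiv_q]
  have h : HasFDerivAt (fun y : Eu N => (2 : ℝ) • innerSL ℝ (y - x₀)) ((2 : ℝ) • innerSL ℝ) x :=
    ((innerSL ℝ).hasFDerivAt.comp x ((hasFDerivAt_id x).sub_const x₀)).const_smul (2 : ℝ)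
  rw [h.fderiv]
  simp
  exact real_inner_self_eq_norm_sq v

lemma grad_q (x₀ x : Eu N) : gradient (fun y : Eu N => ‖y - x₀‖ ^ 2) x = (2 : ℝ) • (x - x₀) := by
  unfold gradient
  rw [fderiv_q]
  apply (InnerProductSpace.toDual ℝ (Eu N)).injective
  ext v
  simp

/-- second order necessary condition -/
lemma Hess_nonpos {φ : Eu N → ℝ} {x : Eu N} (h : ContDiffAt ℝ 2 φ x) (hm : IsLocalMax φ x)
    (v : Eu N) : Hess φ x v ≤ 0 := by
  by_contra hpos
  push Not at hpos
  set l : ℝ → Eu N := fun t => x + t • v with hl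
  have hl0 : l 0 = x := by simp [hl]
  have hlc : Continuous l := by fun_prop
  have hlt : Tendsto l (𝓝 0) (𝓝 x) := by
    have := hlc.tendsto 0
    rwa [hl0] at this
  have hld : ∀ t, HasDerivAt l v t := fun t => by
    have := ((hasDerivAt_id t).smul_const v).const_add x
    rw [one_smul] at this
    exact this
  set f : ℝ → ℝ := fun t => φ (l t) with hf
  have hd : deriv f =ᶠ[𝓝 0] fun t => fderiv ℝ φ (l t) v := by
    filter_upwards [hlt.eventually (ev_diff h)] with t ht
    exact (ht.hasFDerivAt.comp_hasDerivAt t (hld t)).deriv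
  have hdd : deriv (deriv f) 0 = Hess φ x v := by
    rw [hd.deriv_eq]
    have h1 : HasFDerivAt (fderiv ℝ φ) (fderiv ℝ (fderiv ℝ φ) x) (l 0) := by
      rw [hl0]; exact (fderiv_diff h).hasFDerivAt
    have h2 := (h1.comp_hasDerivAt (0 : ℝ) (hld 0)).clm_apply (hasDerivAt_const (0 : ℝ) v)
    have h3 := h2.deriv
    simp only [Function.comp_def] at h3
    rw [h3]
    simp [Hess]
  have hmax : IsLocalMax f 0 := by
    have : ∀ᶠ t in 𝓝 (0 : ℝ), φ (l t) ≤ φ x := hlt.eventually hm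
    filter_upwards [this] with t ht
    simpa [hf, hl0] using ht
  have hfc : ContinuousAt f 0 := by
    have : ContinuousAt φ (l 0) := by rw [hl0]; exact h.continuousAt
    exact ContinuousAt.comp this hlc.continuousAt
  have hmin := isLocalMin_of_deriv_deriv_pos (by rw [hdd]; exact hpos) hmax.deriv_eq_zero hfc
  have hconst : f =ᶠ[𝓝 0] fun _ => f 0 := by
    filter_upwards [hmax, hmin] with t h1 h2
    exact le_antisymm h1 h2
  have h4 := hconst.deriv.deriv_eq
  rw [hdd] at h4
  simp at h4
  linarith

variable (k : ℕ) (H : Eu N → Eu N → ℝ)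

/-- the operator -/
noncomputable def Fop (φ : Eu N → ℝ) (x : Eu N) : ℝ := Pminus k φ x + H x (gradient φ x)

/-- test function comparison -/
lemma Fop_mono (hk : k ≤ N) {φ ψ : Eu N → ℝ} {x : Eu N} (h : ContDiffAt ℝ 2 φ x)
    (h' : ContDiffAt ℝ 2 ψ x) (hm : IsLocalMax (fun y => φ y - ψ y) x) :
    Fop k H φ x ≤ Fop k H ψ x := by
  have hn : ContDiffAt ℝ 2 (fun y => -ψ y) x := h'.neg
  have hsum : ContDiffAt ℝ 2 (fun y => φ y + -ψ y) x := h.add hn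
  have hm' : IsLocalMax (fun y => φ y + -ψ y) x := by simpa only [sub_eq_add_neg] using hm
  have hg : gradient φ x = gradient ψ x := by
    have h1 := grad_add h hn
    rw [grad_neg] at h1
    have h2 : gradient (fun y => φ y + -ψ y) x = 0 := by
      unfold gradient; rw [hm'.fderiv_eq_zero, map_zero]
    rw [h2] at h1
    exact (sub_eq_zero.1 (by rw [sub_eq_add_neg]; exact h1.symm))
  have hP : Pminus k φ x ≤ Pminus k ψ x + k * 0 := by
    refine Pminus_comp k hk _ _ _ _ _ fun v => ?_
    have h1 := Hess_nonpos hsum hm' v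
    rw [Hess_add h hn, Hess_neg] at h1
    linarith
  unfold Fop
  rw [hg]
  linarith

lemma Pminus_cont (hk : k ≤ N) {φ : Eu N → ℝ} {x : Eu N} (h : ContDiffAt ℝ 2 φ x) :
    ContinuousAt (Pminus k φ) x := by
  have hc : ContinuousAt (fderiv ℝ (fderiv ℝ φ)) x :=
    ((h.fderiv_right (m := 1) (by norm_num)).fderiv_right (m := 0) (by norm_num)).continuousAt
  refine Metric.continuousAt_iff.2 ?_
  intro ε hε
  obtain ⟨δ, hδ, hd⟩ := (Metric.continuousAt_iff (α := Eu N)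
    (β := Eu N →L[ℝ] Eu N →L[ℝ] ℝ)).1 hc (ε / (k + 1)) (by positivity)
  refine ⟨δ, hδ, fun y hy => ?_⟩
  have hd := hd hy
  set c := ‖fderiv ℝ (fderiv ℝ φ) y - fderiv ℝ (fderiv ℝ φ) x‖ with hcdef
  have hd : c < ε / (k + 1) :=
    lt_of_eq_of_lt (dist_eq_norm (E := Eu N →L[ℝ] Eu N →L[ℝ] ℝ) _ _).symm hd
  have key : ∀ v, |Hess φ y v - Hess φ x v| ≤ c * ‖v‖ ^ 2 := fun v => by
    have := (fderiv ℝ (fderiv ℝ φ) y - fderiv ℝ (fderiv ℝ φ) x).le_opNorm₂ v v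
    rw [Real.norm_eq_abs, ← hcdef] at this
    simp only [sub_apply] at this
    unfold Hess
    nlinarith [this]
  have h1 := Pminus_comp k hk φ φ y x c fun v => by linarith [(abs_le.1 (key v)).2]
  have h2 := Pminus_comp k hk φ φ x y c fun v => by linarith [(abs_le.1 (key v)).1]
  have hc0 : 0 ≤ c := norm_nonneg (fderiv ℝ (fderiv ℝ φ) y - fderiv ℝ (fderiv ℝ φ) x)
  have h3 : (k : ℝ) * c < ε := by
    rw [lt_div_iff₀ (by positivity)] at hd
    nlinarith
  rw [Real.dist_eq, abs_lt]
  constructor <;> linarith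

lemma Fop_cont (hk : k ≤ N) {Ω : Set (Eu N)} (hΩ : IsOpen Ω)
    (hH : ContinuousOn (Function.uncurry H) (Ω ×ˢ (univ : Set (Eu N))))
    {φ : Eu N → ℝ} {x : Eu N} (hx : x ∈ Ω) (h : ContDiffAt ℝ 2 φ x) :
    ContinuousAt (Fop k H φ) x := by
  have hg : ContinuousAt (gradient φ) x := by
    have : ContinuousAt (fderiv ℝ φ) x := (fderiv_diff h).continuousAt
    exact (InnerProductSpace.toDual ℝ (Eu N)).symm.continuous.continuousAt.comp this
  have h1 : ContinuousAt (Function.uncurry H) (x, gradient φ x) :=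
    hH.continuousAt ((hΩ.prod isOpen_univ).mem_nhds ⟨hx, trivial⟩)
  have h2 : ContinuousAt (fun y => Function.uncurry H (y, gradient φ y)) x :=
    ContinuousAt.comp (f := fun y => (y, gradient φ y)) (x := x) h1 (continuousAt_id.prodMk hg)
  exact (Pminus_cont k hk h).add h2

/-- adding a multiple of the squared distance and a constant -/
lemma pert_contDiff {φ : Eu N → ℝ} {x₀ x : Eu N} (h : ContDiffAt ℝ 2 φ x) (η c : ℝ) :
    ContDiffAt ℝ 2 (fun y => φ y + (η * ‖y - x₀‖ ^ 2 + c)) x :=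
  h.add ((contDiffAt_const.mul (contDiff_q x₀).contDiffAt).add contDiffAt_const)

lemma pert_Hess {φ : Eu N → ℝ} {x₀ x : Eu N} (h : ContDiffAt ℝ 2 φ x) (η c : ℝ) (v : Eu N) :
    Hess (fun y => φ y + (η * ‖y - x₀‖ ^ 2 + c)) x v = Hess φ x v + 2 * η * ‖v‖ ^ 2 := by
  have h1 : ContDiffAt ℝ 2 (fun y : Eu N => η * ‖y - x₀‖ ^ 2) x :=
    contDiffAt_const.mul (contDiff_q x₀).contDiffAt
  rw [Hess_add h (h1.add contDiffAt_const), Hess_add h1 contDiffAt_const,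
    Hess_const_mul (contDiff_q x₀).contDiffAt, Hess_q, Hess_const]
  ring

lemma pert_grad {φ : Eu N → ℝ} {x₀ x : Eu N} (h : ContDiffAt ℝ 2 φ x) (η c : ℝ) :
    gradient (fun y => φ y + (η * ‖y - x₀‖ ^ 2 + c)) x =
      gradient φ x + (2 * η) • (x - x₀) := by
  have h1 : ContDiffAt ℝ 2 (fun y : Eu N => η * ‖y - x₀‖ ^ 2) x :=
    contDiffAt_const.mul (contDiff_q x₀).contDiffAt
  rw [grad_add h (h1.add contDiffAt_const), grad_add h1 contDiffAt_const,
    grad_const_mul (contDiff_q x₀).contDiffAt, grad_q, grad_const, smul_smul, add_zero, mul_comm η]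

lemma Fop_pert (hk : k ≤ N) {φ : Eu N → ℝ} {x₀ : Eu N} (h : ContDiffAt ℝ 2 φ x₀) (η c : ℝ) :
    Fop k H (fun y => φ y + (η * ‖y - x₀‖ ^ 2 + c)) x₀ = Fop k H φ x₀ + 2 * k * η := by
  have h1 := Pminus_comp k hk (fun y => φ y + (η * ‖y - x₀‖ ^ 2 + c)) φ x₀ x₀ (2 * η) fun v => by
    rw [pert_Hess h]
  have h2 := Pminus_comp k hk φ (fun y => φ y + (η * ‖y - x₀‖ ^ 2 + c)) x₀ x₀ (-(2 * η)) fun v => by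
    rw [pert_Hess h]; linarith
  unfold Fop
  rw [pert_grad h, sub_self, smul_zero, add_zero]
  linarith

/-- viscosity subsolution of `F[w] = G(w)` -/
def SubG (Ω : Set (Eu N)) (G : ℝ → ℝ) (w : Eu N → ℝ) : Prop :=
  ∀ x₀ ∈ Ω, ∀ φ : Eu N → ℝ, ContDiffAt ℝ 2 φ x₀ →
    IsLocalMaxOn (fun x => w x - φ x) Ω x₀ → G (w x₀) ≤ Fop k H φ x₀

/-- suprema of subsolutions are subsolutions -/
lemma family_sub (hk : k ≤ N) {Ω : Set (Eu N)} (hΩ : IsOpen Ω)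
    (hH : ContinuousOn (Function.uncurry H) (Ω ×ˢ (univ : Set (Eu N))))
    {G : ℝ → ℝ} (hG : Antitone G) (hGc : Continuous G) (W : Eu N → ℝ) (𝓕 : Set (Eu N → ℝ))
    (h𝓕 : ∀ w ∈ 𝓕, UpperSemicontinuous w ∧ SubG k H Ω G w ∧ ∀ x ∈ Ω, w x ≤ W x)
    (happ : ∀ x₀ ∈ Ω, ∀ τ > 0, ∃ᶠ x in 𝓝 x₀, ∃ w ∈ 𝓕, W x₀ - τ < w x) :
    SubG k H Ω G W := by
  intro x₀ hx₀ φ hφ hmax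
  by_contra hlt
  push Not at hlt
  obtain ⟨η, hη, hηlt⟩ : ∃ η > 0, Fop k H φ x₀ + 2 * k * η < G (W x₀) := by
    refine ⟨(G (W x₀) - Fop k H φ x₀) / (2 * k + 1), by
      apply div_pos (by linarith); positivity, ?_⟩
    have : 2 * (k : ℝ) * ((G (W x₀) - Fop k H φ x₀) / (2 * k + 1)) <
        G (W x₀) - Fop k H φ x₀ := by
      rw [mul_div_assoc', div_lt_iff₀ (by positivity)]
      nlinarith
    linarith
  set ψ : Eu N → ℝ := fun y => φ y + (η * ‖y - x₀‖ ^ 2 + 0) with hψdef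
  have hψ : ContDiffAt ℝ 2 ψ x₀ := pert_contDiff hφ η 0
  have hFψ : Fop k H ψ x₀ < G (ψ x₀ + (W x₀ - ψ x₀)) := by
    rw [add_sub_cancel, hψdef, Fop_pert k H hk hφ]; exact hηlt
  have hev : ∀ᶠ x in 𝓝 x₀, Fop k H ψ x < G (ψ x + (W x₀ - ψ x₀)) :=
    (Fop_cont k H hk hΩ hH hx₀ hψ).eventually_lt
      (hGc.continuousAt.comp (hψ.continuousAt.add continuousAt_const)) hFψ
  have hmax' : ∀ᶠ x in 𝓝 x₀, W x - φ x ≤ W x₀ - φ x₀ := by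
    have := hmax
    rw [IsLocalMaxOn, hΩ.nhdsWithin_eq hx₀] at this
    exact this
  obtain ⟨r, hr, hball⟩ := Metric.nhds_basis_closedBall.eventually_iff.1
    (((hev.and hmax').and (hψ.eventually (by simp))).and (hΩ.mem_nhds hx₀))
  have hψx₀ : ψ x₀ = φ x₀ := by simp [hψdef]
  have hψcont : ∀ᶠ x in 𝓝 x₀, ψ x < ψ x₀ + η * r ^ 2 / 4 :=
    hψ.continuousAt.eventually_lt_const (by
      have : 0 < η * r ^ 2 / 4 := by positivity
      linarith)
  obtain ⟨x₁, ⟨w, hw, hwx⟩, hx₁, hx₁r⟩ := ((happ x₀ hx₀ (η * r ^ 2 / 2) (by positivity)).and_eventually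
    (hψcont.and (closedBall_mem_nhds x₀ hr))).exists
  obtain ⟨husc, hsub, hle⟩ := h𝓕 w hw
  have hcont : ContinuousOn ψ (closedBall x₀ r) := fun y hy =>
    (hball hy).1.2.continuousAt.continuousWithinAt
  have husc2 : UpperSemicontinuousOn (fun y => w y + (-ψ y)) (closedBall x₀ r) :=
    UpperSemicontinuousOn.add (husc.upperSemicontinuousOn _) (hcont.neg.upperSemicontinuousOn)
  obtain ⟨y, hy, hymax⟩ := husc2.exists_isMaxOn ⟨x₀, mem_closedBall_self hr.le⟩
    (isCompact_closedBall x₀ r)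
  have hy1 : w x₁ + -ψ x₁ ≤ w y + -ψ y := hymax hx₁r
  obtain ⟨⟨⟨hy2, hy3⟩, hy4⟩, hy5⟩ := hball hy
  have hψy : ψ y = φ y + (η * ‖y - x₀‖ ^ 2 + 0) := rfl
  have hwy := hle y hy5
  have hyr : ‖y - x₀‖ < r := by
    by_contra hge
    push Not at hge
    have : η * r ^ 2 ≤ η * ‖y - x₀‖ ^ 2 := by gcongr
    have hp : 0 < η * r ^ 2 := by positivity
    linarith
  have hloc : IsLocalMaxOn (fun x => w x - ψ x) Ω y := by
    apply IsLocalMax.on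
    have : ball x₀ r ∈ 𝓝 y := isOpen_ball.mem_nhds (by rwa [mem_ball, dist_eq_norm])
    filter_upwards [this] with z hz
    have : w z + -ψ z ≤ w y + -ψ y := hymax (ball_subset_closedBall hz)
    simpa only [sub_eq_add_neg] using this
  have h1 := hsub y hy5 ψ hy4 hloc
  have h2 : G (ψ y + (W x₀ - ψ x₀)) ≤ G (w y) := by
    apply hG
    have : 0 ≤ η * ‖y - x₀‖ ^ 2 := by positivity
    linarith
  linarith

end Basics

section Upper

variable {N : ℕ}

lemma exists_radial_frame (k : ℕ) (hk1 : 1 ≤ k) (hk : k ≤ N) (d : Eu N) :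
    ∃ ξ : Fin k → Eu N, Orthonormal ℝ ξ ∧ ‖d‖ ^ 2 ≤ ∑ i, inner ℝ d (ξ i) ^ 2 := by
  by_cases hd : d = 0
  · obtain ⟨ξ, hξ⟩ := exists_frame (N := N) k hk
    exact ⟨ξ, hξ, by simp [hd]⟩
  have hN : 0 < N := by omega
  have hdn : ‖d‖ ≠ 0 := norm_ne_zero_iff.2 hd
  have hcard : Module.finrank ℝ (Eu N) = Fintype.card (Fin N) := by simp
  obtain ⟨e, he⟩ := Orthonormal.exists_orthonormalBasis_extension_of_card_eq (𝕜 := ℝ)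
    (E := Eu N) hcard (v := fun _ => (‖d‖)⁻¹ • d) (s := {(⟨0, hN⟩ : Fin N)}) (by
      constructor
      · intro i
        simp [norm_smul, hdn]
      · intro i j hij
        exact absurd (Subsingleton.elim i j) hij)
  have he0 := he ⟨0, hN⟩ rfl
  refine ⟨fun i => e (Fin.castLE hk i), e.orthonormal.comp _ (Fin.castLE_injective hk), ?_⟩
  have h1 := Finset.single_le_sum (f := fun i : Fin k => inner ℝ d (e (Fin.castLE hk i)) ^ 2)
    (fun i _ => sq_nonneg _) (Finset.mem_univ (⟨0, by omega⟩ : Fin k))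
  refine le_trans (le_of_eq ?_) h1
  have : Fin.castLE hk (⟨0, by omega⟩ : Fin k) = ⟨0, hN⟩ := rfl
  simp only [this, he0, inner_smul_right, real_inner_self_eq_norm_sq]
  field_simp

lemma contDiff_h (x₀ : Eu N) (r : ℝ) : ContDiff ℝ 2 (fun y : Eu N => (r ^ 2 - ‖y - x₀‖ ^ 2) ^ 2) :=
  (contDiff_const.sub (contDiff_q x₀)).pow 2

lemma fderiv_h (x₀ : Eu N) (r : ℝ) : fderiv ℝ (fun y : Eu N => (r ^ 2 - ‖y - x₀‖ ^ 2) ^ 2) =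
    fun y => (-4 * (r ^ 2 - ‖y - x₀‖ ^ 2)) • innerSL ℝ (y - x₀) := by
  ext1 y
  have hq : HasFDerivAt (fun y : Eu N => ‖y - x₀‖ ^ 2) ((2 : ℝ) • innerSL ℝ (y - x₀)) y := by
    have := ((contDiff_q x₀).differentiable (by norm_num) y).hasFDerivAt
    rwa [fderiv_q] at this
  have h := (hq.const_sub (r ^ 2)).pow 2
  rw [h.fderiv]
  ext v
  simp
  ring

lemma grad_h (x₀ x : Eu N) (r : ℝ) : gradient (fun y : Eu N => (r ^ 2 - ‖y - x₀‖ ^ 2) ^ 2) x =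
    (-4 * (r ^ 2 - ‖x - x₀‖ ^ 2)) • (x - x₀) := by
  unfold gradient
  rw [fderiv_h]
  apply (InnerProductSpace.toDual ℝ (Eu N)).injective
  ext v
  simp

lemma Hess_h (x₀ x v : Eu N) (r : ℝ) : Hess (fun y : Eu N => (r ^ 2 - ‖y - x₀‖ ^ 2) ^ 2) x v =
    8 * inner ℝ (x - x₀) v ^ 2 - 4 * (r ^ 2 - ‖x - x₀‖ ^ 2) * ‖v‖ ^ 2 := by
  unfold Hess
  rw [fderiv_h]
  have hq : HasFDerivAt (fun y : Eu N => ‖y - x₀‖ ^ 2) ((2 : ℝ) • innerSL ℝ (x - x₀)) x := by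
    have := ((contDiff_q x₀).differentiable (by norm_num) x).hasFDerivAt
    rwa [fderiv_q] at this
  have hc := (hq.const_sub (r ^ 2)).const_mul (-4)
  have hi : HasFDerivAt (fun y : Eu N => innerSL ℝ (y - x₀)) (innerSL ℝ) x :=
    (innerSL ℝ).hasFDerivAt.comp x ((hasFDerivAt_id x).sub_const x₀)
  have h := hc.smul hi
  have h2 := h.fderiv
  have h3 := congrArg (fun L => L v v) h2
  refine h3.trans ?_
  have hv : (innerSL ℝ v) v = ‖v‖ ^ 2 := real_inner_self_eq_norm_sq v
  have hv2 : (innerSL ℝ (x - x₀)) v = inner ℝ (x - x₀) v := rfl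
  simp only [add_apply, smul_apply, ContinuousLinearMap.smulRight_apply, neg_apply, hv, hv2,
    smul_eq_mul]
  ring

lemma touch {w h : Eu N → ℝ} {K : Set (Eu N)} (hK : IsCompact K) (hw : UpperSemicontinuousOn w K)
    (hneg : ∀ x ∈ K, w x < 0) (hc : Continuous h) (h0 : ∀ x ∈ K, 0 ≤ h x) {A : ℝ} (hA : 0 < A)
    (hhA : ∀ x ∈ K, h x ≤ A) {x₀ : Eu N} (hx₀ : x₀ ∈ K) (hpos : 0 < h x₀) :
    ∃ t > 0, ∃ x ∈ K, w x = -(t * h x) ∧ 0 < h x ∧ ∀ y ∈ K, w y ≤ -(t * h y) := by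
  set S : Set ℝ := {t | ∀ y ∈ K, w y + t * h y ≤ 0} with hS
  have hS0 : (0 : ℝ) ∈ S := fun y hy => by
    have := hneg y hy
    linarith
  have hSb : BddAbove S := ⟨-w x₀ / h x₀, fun t ht => by
    rw [le_div_iff₀ hpos]
    have := ht x₀ hx₀
    linarith⟩
  have hcl : IsClosed S := by
    have : S = ⋂ y ∈ K, {t | w y + t * h y ≤ 0} := by ext t; simp [hS]
    rw [this]
    exact isClosed_biInter fun y _ => isClosed_le (by fun_prop) continuous_const
  set t := sSup S with ht
  have htS : t ∈ S := hcl.csSup_mem ⟨0, hS0⟩ hSb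
  have husc : UpperSemicontinuousOn (fun y => w y + t * h y) K :=
    hw.add ((continuous_const.mul hc).continuousOn.upperSemicontinuousOn)
  obtain ⟨x, hx, hxm⟩ := husc.exists_isMaxOn ⟨x₀, hx₀⟩ hK
  have hx0 : w x + t * h x = 0 := by
    by_contra hne
    have hlt : w x + t * h x < 0 := lt_of_le_of_ne (htS x hx) hne
    set c := -(w x + t * h x) with hcc
    have hcp : 0 < c := by linarith
    have : t + c / A ∈ S := fun y hy => by
      have h1 : w y + t * h y ≤ w x + t * h x := hxm hy
      have h2 : c / A * h y ≤ c := by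
        rw [div_mul_eq_mul_div, div_le_iff₀ hA]
        exact mul_le_mul_of_nonneg_left (hhA y hy) hcp.le
      have : (t + c / A) * h y = t * h y + c / A * h y := by ring
      linarith
    have := le_csSup hSb this
    have : 0 < c / A := by positivity
    linarith
  have hwx := hneg x hx
  have ht0 : 0 ≤ t := le_csSup hSb hS0
  have hth : 0 < t * h x := by linarith
  have hhx : 0 < h x := by
    rcases (h0 x hx).lt_or_eq with h | h
    · exact h
    · rw [← h] at hth; simp at hth
  refine ⟨t, pos_of_mul_pos_left hth hhx.le, x, hx, by linarith, hhx, fun y hy => ?_⟩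
  have := htS y hy
  linarith

lemma upper_bound (k : ℕ) (hk1 : 1 ≤ k) (hk : k ≤ N) {Ω : Set (Eu N)}
    {H : Eu N → Eu N → ℝ} {b : ℝ} (hb : 0 ≤ b) (hSC1 : SC1 Ω H b) {x₀ : Eu N} {r : ℝ}
    (hr : 0 < r) (hball : closedBall x₀ r ⊆ Ω) {μ : ℝ} {w : Eu N → ℝ}
    (hw : UpperSemicontinuousOn w (closure Ω)) (hneg : ∀ x ∈ closure Ω, w x < 0)
    (hsub : IsViscSubsol (Pminus k) Ω H μ (fun _ => 0) w) :
    μ ≤ (8 + 4 * k + 4 * b * r) ^ 2 / (32 * r ^ 2) := by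
  set h : Eu N → ℝ := fun y => (r ^ 2 - ‖y - x₀‖ ^ 2) ^ 2 with hh
  have hsubc : closedBall x₀ r ⊆ closure Ω := hball.trans subset_closure
  have hmem : ∀ x ∈ closedBall x₀ r, ‖x - x₀‖ ≤ r := fun x hx => by
    rwa [mem_closedBall, dist_eq_norm] at hx
  obtain ⟨t, ht, x, hx, hwx, hhx, hle⟩ := touch (isCompact_closedBall x₀ r) (hw.mono hsubc)
    (fun x hx => hneg x (hsubc hx)) (contDiff_h x₀ r).continuous (fun x _ => sq_nonneg _)
    (A := (r ^ 2) ^ 2) (by positivity) (fun x hx => by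
      have h1 := hmem x hx
      have h2 : ‖x - x₀‖ ^ 2 ≤ r ^ 2 := by gcongr
      have h3 : 0 ≤ ‖x - x₀‖ ^ 2 := by positivity
      gcongr
      linarith)
    (x₀ := x₀) (mem_closedBall_self hr.le) (by simp; positivity)
  have hxr := hmem x hx
  set s := r ^ 2 - ‖x - x₀‖ ^ 2 with hs
  have hs0 : 0 ≤ s := by
    have h2 : ‖x - x₀‖ ^ 2 ≤ r ^ 2 := by gcongr
    linarith
  have hsp : 0 < s := by
    rcases hs0.lt_or_eq with h | h
    · exact h
    · rw [← h] at hhx; simp at hhx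
  have hxlt : x ∈ ball x₀ r := by
    rw [mem_ball, dist_eq_norm]
    exact lt_of_pow_lt_pow_left₀ 2 hr.le (by linarith)
  have hcd : ContDiffAt ℝ 2 h x := (contDiff_h x₀ r).contDiffAt
  have hcd2 : ContDiffAt ℝ 2 (fun y => t * h y) x := contDiffAt_const.mul hcd
  have key := hsub x (hball hx) (fun y => -(t * h y)) hcd2.neg (by
    apply IsLocalMax.on
    filter_upwards [isOpen_ball.mem_nhds hxlt] with y hy
    have := hle y (ball_subset_closedBall hy)
    have h2 : w x = -(t * h x) := hwx
    show w y - -(t * h y) ≤ w x - -(t * h x)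
    linarith)
  have hP : Pminus k (fun y => -(t * h y)) x ≤ -(t * (8 * ‖x - x₀‖ ^ 2 - 4 * k * s)) := by
    obtain ⟨ξ, hξ, hξs⟩ := exists_radial_frame k hk1 hk (x - x₀)
    refine (Pminus_le k _ x ξ hξ).trans ?_
    have : ∀ i, Hess (fun y => -(t * h y)) x (ξ i) =
        -(t * 8) * inner ℝ (x - x₀) (ξ i) ^ 2 + t * 4 * s := fun i => by
      rw [Hess_neg, Hess_const_mul hcd, hh, Hess_h, hξ.1 i]
      ring
    simp only [this, Finset.sum_add_distrib, ← Finset.mul_sum, Finset.sum_const, Finset.card_univ,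
      Fintype.card_fin, nsmul_eq_mul]
    nlinarith
  have hHb : H x (gradient (fun y => -(t * h y)) x) ≤ t * (4 * b * s * r) := by
    have h1 := (abs_le.1 (hSC1 x (hball hx) (gradient (fun y => -(t * h y)) x))).2
    refine h1.trans ?_
    rw [grad_neg, grad_const_mul hcd, hh, grad_h, norm_neg, norm_smul, norm_smul, ← hs,
      Real.norm_eq_abs, Real.norm_eq_abs, abs_of_pos ht, abs_mul, abs_of_pos hsp]
    have : |(-4 : ℝ)| = 4 := by norm_num
    rw [this]
    have : 0 ≤ b * t * s := by positivity
    nlinarith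
  have hwx' : w x = -(t * s ^ 2) := hwx
  simp only [hwx'] at key
  have k1 : 0 ≤ t * (-(8 * ‖x - x₀‖ ^ 2 - 4 * k * s) + 4 * b * s * r - μ * s ^ 2) := by
    linarith
  have k2 := nonneg_of_mul_nonneg_right k1 ht
  have hd2 : ‖x - x₀‖ ^ 2 = r ^ 2 - s := by linarith
  rw [hd2] at k2
  rw [le_div_iff₀ (by positivity)]
  set A := 8 + 4 * (k : ℝ) + 4 * b * r with hA
  have k3 : μ * s ^ 2 ≤ A * s - 8 * r ^ 2 := by rw [hA]; linarith
  have k4 : μ * (32 * r ^ 2) * s ^ 2 ≤ A ^ 2 * s ^ 2 := by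
    nlinarith [sq_nonneg (A * s - 16 * r ^ 2), sq_nonneg r, mul_le_mul_of_nonneg_left k3 (show 0 ≤ 32 * r ^ 2 by positivity)]
  exact le_of_mul_le_mul_right k4 (by positivity)

end Upper

section Perron

variable {N : ℕ}

/-- upper envelope -/
noncomputable def uEnv (u : Eu N → ℝ) (x : Eu N) : ℝ := sInf {c | ∀ᶠ y in 𝓝 x, u y ≤ c}

/-- lower envelope -/
noncomputable def lEnv (u : Eu N → ℝ) (x : Eu N) : ℝ := sSup {c | ∀ᶠ y in 𝓝 x, c ≤ u y}

lemma uEnv_le {u : Eu N → ℝ} {x : Eu N} {c : ℝ} (h : ∀ᶠ y in 𝓝 x, u y ≤ c) : uEnv u x ≤ c :=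
  csInf_le ⟨u x, fun c hd => Eventually.self_of_nhds (p := fun y => u y ≤ c) hd⟩ h

lemma le_uEnv {u : Eu N → ℝ} (hu : ∀ x, u x ≤ 0) (x : Eu N) : u x ≤ uEnv u x :=
  le_csInf ⟨0, Eventually.of_forall hu⟩ fun c hd =>
    Eventually.self_of_nhds (p := fun y => u y ≤ c) hd

lemma uEnv_usc {u : Eu N → ℝ} (hu : ∀ x, u x ≤ 0) : UpperSemicontinuous (uEnv u) := by
  intro x d hd
  obtain ⟨c, hc, hcd⟩ := exists_lt_of_csInf_lt
    (show {c | ∀ᶠ y in 𝓝 x, u y ≤ c}.Nonempty from ⟨0, Eventually.of_forall hu⟩) hd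
  filter_upwards [eventually_eventually_nhds.2 hc] with y hy
  exact (uEnv_le hy).trans_lt hcd

lemma le_lEnv {u : Eu N → ℝ} {x : Eu N} {c : ℝ} (h : ∀ᶠ y in 𝓝 x, c ≤ u y) : c ≤ lEnv u x :=
  le_csSup ⟨u x, fun c hd => Eventually.self_of_nhds (p := fun y => c ≤ u y) hd⟩ h

lemma lEnv_nonempty {u L : Eu N → ℝ} (hL : Continuous L) (hu : ∀ x, L x ≤ u x) (x : Eu N) :
    {c | ∀ᶠ y in 𝓝 x, c ≤ u y}.Nonempty := by
  refine ⟨L x - 1, ?_⟩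
  filter_upwards [hL.continuousAt.eventually_const_lt (show L x - 1 < L x by linarith)] with y hy
  exact hy.le.trans (hu y)

lemma lEnv_le {u L : Eu N → ℝ} (hL : Continuous L) (hu : ∀ x, L x ≤ u x) (x : Eu N) :
    lEnv u x ≤ u x :=
  csSup_le (lEnv_nonempty hL hu x) fun c hd =>
    Eventually.self_of_nhds (p := fun y => c ≤ u y) hd

lemma lEnv_lsc {u L : Eu N → ℝ} (hL : Continuous L) (hu : ∀ x, L x ≤ u x) :
    LowerSemicontinuous (lEnv u) := by
  intro x d hd
  obtain ⟨c, hc, hcd⟩ := exists_lt_of_lt_csSup (lEnv_nonempty hL hu x) hd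
  filter_upwards [eventually_eventually_nhds.2 hc] with y hy
  exact hcd.trans_le (le_lEnv hy)

lemma le_lEnv_cont {u f : Eu N → ℝ} {x : Eu N} (hf : ContinuousAt f x)
    (h : ∀ᶠ y in 𝓝 x, f y ≤ u y) : f x ≤ lEnv u x := by
  refine le_of_forall_lt fun c hc => ?_
  obtain ⟨d, hcd, hdf⟩ := exists_between hc
  refine hcd.trans_le (le_lEnv ?_)
  filter_upwards [h, hf.eventually_const_lt hdf] with y h1 h2
  exact h2.le.trans h1

variable (k : ℕ) (H : Eu N → Eu N → ℝ) (Ω : Set (Eu N))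

/-- the Perron class -/
def PClass (G : ℝ → ℝ) (L : Eu N → ℝ) : Set (Eu N → ℝ) :=
  {w | UpperSemicontinuous w ∧ (∀ x, L x ≤ w x) ∧ (∀ x, w x ≤ 0) ∧ SubG k H Ω G w}

lemma perron_max (hk : k ≤ N) (hΩ : IsOpen Ω)
    (hH : ContinuousOn (Function.uncurry H) (Ω ×ˢ (univ : Set (Eu N))))
    {G : ℝ → ℝ} (hG : Antitone G) (hGc : Continuous G) {L : Eu N → ℝ}
    (hL : L ∈ PClass k H Ω G L) :
    ∃ U ∈ PClass k H Ω G L, ∀ w ∈ PClass k H Ω G L, ∀ x, w x ≤ U x := by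
  set T := PClass k H Ω G L with hT
  have : Nonempty T := ⟨⟨L, hL⟩⟩
  set u : Eu N → ℝ := fun x => ⨆ w : T, w.1 x with hu
  have hbdd : ∀ x, BddAbove (range fun w : T => w.1 x) := fun x => ⟨0, by
    rintro _ ⟨w, rfl⟩
    exact w.2.2.2.1 x⟩
  have hu0 : ∀ x, u x ≤ 0 := fun x => ciSup_le fun w => w.2.2.2.1 x
  have hwu : ∀ w ∈ T, ∀ x, w x ≤ u x := fun w hw x => le_ciSup (hbdd x) ⟨w, hw⟩
  have hwU : ∀ w ∈ T, ∀ x, w x ≤ uEnv u x := fun w hw x => (hwu w hw x).trans (le_uEnv hu0 x)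
  refine ⟨uEnv u, ⟨uEnv_usc hu0, hwU L hL, fun x => uEnv_le (Eventually.of_forall hu0), ?_⟩, hwU⟩
  refine family_sub k H hk hΩ hH hG hGc _ T (fun w hw => ⟨hw.1, hw.2.2.2, fun x _ => hwU w hw x⟩) ?_
  intro x₀ _ τ hτ hcon
  have : uEnv u x₀ ≤ uEnv u x₀ - τ := by
    apply uEnv_le
    filter_upwards [hcon] with y hy
    refine ciSup_le fun w => ?_
    by_contra hlt
    push Not at hlt
    exact hy ⟨w.1, w.2, hlt⟩
  linarith

lemma barrier (hk : k ≤ N) (hΩ : IsOpen Ω) (hne : Ω.Nonempty)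
    (hH : ContinuousOn (Function.uncurry H) (Ω ×ˢ (univ : Set (Eu N)))) {b : ℝ} (hb : 0 ≤ b)
    (hSC1 : SC1 Ω H b) {R : ℝ} (hR : 0 < R) (hhoop : HulaHoop R Ω) (hbR : b * R < k)
    {M : ℝ} (hM : 0 ≤ M) :
    ∃ L : Eu N → ℝ, Continuous L ∧ (∀ x, L x ≤ 0) ∧ (∀ x ∉ Ω, L x = 0) ∧
      ∀ G : ℝ → ℝ, Antitone G → Continuous G → (∀ s, G s ≤ M) → SubG k H Ω G L := by
  obtain ⟨Y, hY, hΩY⟩ := hhoop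
  have : Nonempty Y := hY.to_subtype
  obtain ⟨x₁, hx₁⟩ := hne
  have hmem : ∀ x, x ∈ Ω ↔ ∀ y ∈ Y, dist x y < R := fun x => by rw [hΩY]; simp
  set ρ : Eu N → ℝ := fun x => ⨆ y : Y, dist x y.1 with hρ
  have hbdd : ∀ x, BddAbove (range fun y : Y => dist x y.1) := fun x => ⟨dist x x₁ + R, by
    rintro _ ⟨y, rfl⟩
    have h1 := dist_triangle x x₁ y.1
    have h2 := (hmem x₁).1 hx₁ y.1 y.2
    simp only
    linarith⟩
  have hle : ∀ x, ∀ y ∈ Y, dist x y ≤ ρ x := fun x y hy => le_ciSup (hbdd x) ⟨y, hy⟩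
  have hρ0 : ∀ x, 0 ≤ ρ x := fun x => by
    obtain ⟨y, hy⟩ := hY
    exact dist_nonneg.trans (hle x y hy)
  have hρc : Continuous ρ := by
    refine (LipschitzWith.of_le_add fun x z => ciSup_le fun y => ?_).continuous
    have h1 := dist_triangle x z y.1
    have h2 := hle z y.1 y.2
    linarith
  have hρR : ∀ x ∈ Ω, ρ x ≤ R := fun x hx => ciSup_le fun y => ((hmem x).1 hx y.1 y.2).le
  have hgap : 0 < k - b * R := by linarith
  set C := M / (2 * (k - b * R)) with hC
  have hC0 : 0 ≤ C := by positivity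
  have hCM : C * (2 * (k - b * R)) = M := by rw [hC]; field_simp
  have hLΩ : ∀ x ∈ Ω, C * min 0 (ρ x ^ 2 - R ^ 2) = C * (ρ x ^ 2 - R ^ 2) := fun x hx => by
    have h1 := hρR x hx
    have h2 := hρ0 x
    rw [min_eq_right]
    nlinarith
  refine ⟨fun x => C * min 0 (ρ x ^ 2 - R ^ 2), by fun_prop, fun x =>
    mul_nonpos_of_nonneg_of_nonpos hC0 (min_le_left _ _), fun x hx => ?_, ?_⟩
  · rw [hmem] at hx
    push Not at hx
    obtain ⟨y, hy, hxy⟩ := hx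
    have h1 := hle x y hy
    show C * min 0 (ρ x ^ 2 - R ^ 2) = 0
    rw [min_eq_left, mul_zero]
    nlinarith
  intro G hG hGc hGM
  refine family_sub k H hk hΩ hH hG hGc _
    {w | ∃ y ∈ Y, w = fun x => 0 + (C * ‖x - y‖ ^ 2 + C * (-R ^ 2))} ?_ ?_
  · rintro w ⟨y, hy, rfl⟩
    refine ⟨(by fun_prop : Continuous fun x : Eu N => 0 + (C * ‖x - y‖ ^ 2 + C * (-R ^ 2))).upperSemicontinuous, ?_, ?_⟩
    · intro x₀ hx₀ φ hφ hmax
      refine (hGM _).trans ?_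
      have hz : ContDiffAt ℝ 2 (fun _ : Eu N => (0 : ℝ)) x₀ := contDiffAt_const
      have h1 := Fop_mono k H hk (pert_contDiff (x₀ := y) hz C (C * (-R ^ 2))) hφ
        (hmax.isLocalMax (hΩ.mem_nhds hx₀))
      refine le_trans ?_ h1
      have h2 : 2 * C * k ≤ Pminus k (fun x => 0 + (C * ‖x - y‖ ^ 2 + C * (-R ^ 2))) x₀ := by
        refine le_Pminus k hk _ _ _ fun ξ hξ => ?_
        simp only [pert_Hess hz, hξ.1, Hess_const]
        simp
        linarith
      have h3 := (abs_le.1 (hSC1 x₀ hx₀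
        (gradient (fun x => 0 + (C * ‖x - y‖ ^ 2 + C * (-R ^ 2))) x₀))).1
      have h4 : ‖gradient (fun x => 0 + (C * ‖x - y‖ ^ 2 + C * (-R ^ 2))) x₀‖ ≤ 2 * C * R := by
        rw [pert_grad hz, grad_const, zero_add, norm_smul, Real.norm_eq_abs,
          abs_of_nonneg (by positivity), ← dist_eq_norm]
        have := ((hmem x₀).1 hx₀ y hy).le
        gcongr
      have h5 := mul_le_mul_of_nonneg_left h4 hb
      unfold Fop
      linarith
    · intro x hx
      simp only [hLΩ x hx]
      have h1 := hle x y hy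
      rw [dist_eq_norm] at h1
      have h2 : ‖x - y‖ ^ 2 ≤ ρ x ^ 2 := by gcongr
      have h3 := mul_le_mul_of_nonneg_left h2 hC0
      linarith
  · intro x₀ hx₀ τ hτ hcon
    refine hcon.self_of_nhds ?_
    have hδ : 0 < τ / (2 * C * R + 1) := by positivity
    obtain ⟨y, hy⟩ := exists_lt_of_lt_ciSup
      (show ρ x₀ - τ / (2 * C * R + 1) < ⨆ y : Y, dist x₀ y.1 by
        change ρ x₀ - τ / (2 * C * R + 1) < ρ x₀
        linarith)
    refine ⟨_, ⟨y.1, y.2, rfl⟩, ?_⟩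
    simp only [hLΩ x₀ hx₀]
    rw [← dist_eq_norm]
    have h1 := hle x₀ y.1 y.2
    have h2 := hρR x₀ hx₀
    have h3 : (0 : ℝ) ≤ dist x₀ y.1 := dist_nonneg
    set d := dist x₀ y.1
    set δ := τ / (2 * C * R + 1) with hδd
    have h4 : 2 * C * R * δ < τ := by
      have : δ * (2 * C * R + 1) = τ := by rw [hδd]; field_simp
      linarith
    have h5 : ρ x₀ ^ 2 - d ^ 2 ≤ δ * (2 * R) := by
      have : ρ x₀ ^ 2 - d ^ 2 = (ρ x₀ - d) * (ρ x₀ + d) := by ring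
      rw [this]
      apply mul_le_mul <;> linarith
    have h6 := mul_le_mul_of_nonneg_left h5 hC0
    linarith

end Perron

section Main

variable {N : ℕ}

/-- the bump lemma -/
lemma bump (k : ℕ) (H : Eu N → Eu N → ℝ) (Ω : Set (Eu N)) (hk : k ≤ N)
    {G : ℝ → ℝ} {L U ψ : Eu N → ℝ} {x₀ : Eu N} {r : ℝ} (hr : 0 < r)
    (hU : U ∈ PClass k H Ω G L) (hmaxU : ∀ w ∈ PClass k H Ω G L, ∀ x, w x ≤ U x)
    (hψ : ∀ x ∈ closedBall x₀ r, ContDiffAt ℝ 2 ψ x) (hψ0 : ∀ x ∈ closedBall x₀ r, ψ x ≤ 0)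
    (hψG : ∀ x ∈ closedBall x₀ r, G (ψ x) ≤ Fop k H ψ x)
    (hψU : ∀ x ∈ closedBall x₀ r, r / 2 ≤ dist x x₀ → ψ x ≤ U x) (hΩ : IsOpen Ω) :
    ∀ᶠ x in 𝓝 x₀, ψ x ≤ U x := by
  classical
  set W : Eu N → ℝ := fun x => if dist x x₀ < r then max (U x) (ψ x) else U x with hW
  have hUW : ∀ x, U x ≤ W x := fun x => by
    simp only [hW]; split_ifs
    · exact le_max_left _ _
    · exact le_rfl
  have hWout : ∀ x, r / 2 ≤ dist x x₀ → W x = U x := fun x hx => by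
    simp only [hW]; split_ifs with h
    · exact max_eq_left (hψU x (mem_closedBall.2 h.le) hx)
    · rfl
  have hWin : ∀ x, dist x x₀ < r → W x = max (U x) (ψ x) := fun x hx => by
    simp only [hW]; rw [if_pos hx]
  have hWT : W ∈ PClass k H Ω G L := by
    refine ⟨?_, fun x => (hU.2.1 x).trans (hUW x), fun x => ?_, ?_⟩
    · intro x c hc
      rcases lt_or_ge (dist x x₀) r with h | h
      · rw [hWin x h] at hc
        have h1 := hU.1 x c (lt_of_le_of_lt (le_max_left _ _) hc)
        have h2 := (hψ x (mem_closedBall.2 h.le)).continuousAt.eventually_lt_const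
          (lt_of_le_of_lt (le_max_right _ _) hc)
        filter_upwards [h1, h2, isOpen_ball.mem_nhds (mem_ball.2 h)] with y h3 h4 h5
        rw [hWin y (mem_ball.1 h5)]
        exact max_lt h3 h4
      · rw [hWout x (by linarith)] at hc
        have h2 : ∀ᶠ y in 𝓝 x, r / 2 < dist y x₀ :=
          (continuous_id.dist continuous_const).continuousAt.eventually_const_lt
            (by simp only [id]; linarith)
        filter_upwards [hU.1 x c hc, h2] with y h3 h4
        rwa [hWout y h4.le]
    · simp only [hW]; split_ifs with h
      · exact max_le (hU.2.2.1 x) (hψ0 x (mem_closedBall.2 h.le))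
      · exact hU.2.2.1 x
    · intro y hy χ hχ hm
      by_cases hcase : W y = U y
      · rw [hcase]
        refine hU.2.2.2 y hy χ hχ ?_
        filter_upwards [hm] with z hz
        have := hUW z
        rw [hcase] at hz
        linarith
      · have hyr : dist y x₀ < r / 2 := by
          by_contra hge
          push Not at hge
          exact hcase (hWout y hge)
        have hyr' : dist y x₀ < r := by linarith
        have hyc := mem_closedBall.2 hyr'.le
        have hWy : W y = ψ y := by
          have h1 := hWin y hyr'
          rcases max_choice (U y) (ψ y) with h | h
          · rw [h] at h1; exact absurd h1 hcase
          · rw [h] at h1; exact h1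
        rw [hWy]
        refine (hψG y hyc).trans (Fop_mono k H hk (hψ y hyc) hχ ?_)
        filter_upwards [hm.isLocalMax (hΩ.mem_nhds hy), isOpen_ball.mem_nhds (mem_ball.2 hyr')]
          with z hz hzr
        have h1 := hWin z (mem_ball.1 hzr)
        have h2 := le_max_right (U z) (ψ z)
        rw [hWy] at hz
        linarith
  filter_upwards [ball_mem_nhds x₀ hr] with x hx
  have h1 := hmaxU W hWT x
  rw [hWin x (mem_ball.1 hx)] at h1
  exact (le_max_right _ _).trans h1

/-- the truncated zero order term -/
noncomputable def Gn (m : ℝ) (n : ℕ) (s : ℝ) : ℝ := 1 / ((n : ℝ) + 1) - m * max s (-1)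

lemma Gn_anti {m : ℝ} (hm : 0 ≤ m) (n : ℕ) : Antitone (Gn m n) := fun s t hst => by
  have h := mul_le_mul_of_nonneg_left (max_le_max_right (-1 : ℝ) hst) hm
  unfold Gn
  linarith

lemma Gn_cont (m : ℝ) (n : ℕ) : Continuous (Gn m n) := by
  unfold Gn
  fun_prop

lemma inv_le_one_n (n : ℕ) : 1 / ((n : ℝ) + 1) ≤ 1 := by
  rw [div_le_one (by positivity)]
  have : (0 : ℝ) ≤ n := by positivity
  linarith

lemma Gn_le {m : ℝ} (hm : 0 ≤ m) (n : ℕ) (s : ℝ) : Gn m n s ≤ 1 + m := by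
  have h := mul_le_mul_of_nonneg_left (le_max_right s (-1 : ℝ)) hm
  have h2 := inv_le_one_n n
  unfold Gn
  linarith

lemma exists_super (k : ℕ) (H : Eu N → Eu N → ℝ) (Ω : Set (Eu N)) (hk : k ≤ N) (hΩ : IsOpen Ω)
    (hbd : Bornology.IsBounded Ω)
    (hH : ContinuousOn (Function.uncurry H) (Ω ×ˢ (univ : Set (Eu N))))
    (hSC2 : SC2 Ω H) {m : ℝ} (hm : 0 ≤ m) {L : Eu N → ℝ} (hLc : Continuous L)
    (hL0 : ∀ x, L x ≤ 0) (hLout : ∀ x ∉ Ω, L x = 0)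
    (hLsub : ∀ n, SubG k H Ω (Gn m n) L)
    (hmax : ∀ μ : ℝ, ∀ w : Eu N → ℝ, UpperSemicontinuous w → (∀ x, w x < 0) →
      IsViscSubsol (Pminus k) Ω H μ (fun _ => 0) w → μ ≤ m) :
    ∃ v : Eu N → ℝ, LowerSemicontinuous v ∧ (∀ x, v x ≤ 0) ∧ (∃ x ∈ Ω, v x ≠ 0) ∧
      (∀ x ∉ Ω, v x = 0) ∧ IsViscSupersol (Pminus k) Ω H m (fun _ => 0) v := by
  have hLT : ∀ n, L ∈ PClass k H Ω (Gn m n) L := fun n =>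
    ⟨hLc.upperSemicontinuous, fun _ => le_rfl, hL0, hLsub n⟩
  choose U hU hUmax using fun n => perron_max k H Ω hk hΩ hH (Gn_anti hm n) (Gn_cont m n) (hLT n)
  have hUmono : ∀ n j, n ≤ j → ∀ x, U n x ≤ U j x := fun n j hnj x => by
    refine hUmax j (U n) ⟨(hU n).1, (hU n).2.1, (hU n).2.2.1, ?_⟩ x
    intro x₀ hx₀ φ hφ hloc
    refine le_trans ?_ ((hU n).2.2.2 x₀ hx₀ φ hφ hloc)
    have : 1 / ((j : ℝ) + 1) ≤ 1 / ((n : ℝ) + 1) := by gcongr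
    unfold Gn
    linarith
  set V : ℕ → Eu N → ℝ := fun n => lEnv (U n) with hV
  have hVU : ∀ n x, V n x ≤ U n x := fun n x => lEnv_le hLc (hU n).2.1 x
  have hLV : ∀ n x, L x ≤ V n x := fun n x =>
    le_lEnv_cont hLc.continuousAt (Eventually.of_forall (hU n).2.1)
  have hVlsc : ∀ n, LowerSemicontinuous (V n) := fun n => lEnv_lsc hLc (hU n).2.1
  have hV0 : ∀ n x, V n x ≤ 0 := fun n x => (hVU n x).trans ((hU n).2.2.1 x)
  have hVmono : ∀ n j, n ≤ j → ∀ x, V n x ≤ V j x := fun n j hnj x => by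
    refine csSup_le (lEnv_nonempty hLc (hU n).2.1 x) fun c hc => le_lEnv ?_
    filter_upwards [hc] with y hy
    exact le_trans hy (hUmono n j hnj y)
  have hbdd : ∀ x, BddAbove (range fun n => V n x) := fun x => ⟨0, by
    rintro _ ⟨n, rfl⟩
    exact hV0 n x⟩
  set v : Eu N → ℝ := fun x => ⨆ n, V n x with hv
  have hVv : ∀ n x, V n x ≤ v x := fun n x => le_ciSup (hbdd x) n
  have hv0 : ∀ x, v x ≤ 0 := fun x => ciSup_le fun n => hV0 n x
  have hvout : ∀ x ∉ Ω, v x = 0 := fun x hx =>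
    le_antisymm (hv0 x) ((hLout x hx).symm.le.trans ((hLV 0 x).trans (hVv 0 x)))
  -- nontriviality at each level
  have hlow : ∀ n, ∃ x, V n x ≤ -1 := by
    intro n
    by_contra hcon
    push Not at hcon
    set ε : ℝ := 1 / ((n : ℝ) + 1) with hε
    have hε0 : 0 < ε := by positivity
    have hε1 : ε ≤ 1 := inv_le_one_n n
    set s : ℝ := ε / (2 * (m + 1)) with hs
    have hs0 : 0 < s := by positivity
    have hsm : (m + 1) * s = ε / 2 := by rw [hs]; field_simp
    have := hmax (m + ε / 2) (fun x => U n x + -s)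
      ((hU n).1.add continuous_const.upperSemicontinuous)
      (fun x => by have := (hU n).2.2.1 x; linarith) (by
        intro x₀ hx₀ φ hφ hloc
        have h1 := (hU n).2.2.2 x₀ hx₀ φ hφ (by
          filter_upwards [hloc] with z hz
          linarith)
        have h2 : -1 < U n x₀ := (hcon x₀).trans_le (hVU n x₀)
        unfold Gn Fop at h1
        rw [max_eq_left h2.le, ← hε] at h1
        have h3 : (m + ε / 2) * (U n x₀ + -s) =
          m * U n x₀ + ε / 2 * U n x₀ - (m + ε / 2) * s := by ring
        have h4 : (m + ε / 2) * s ≤ (m + 1) * s := by gcongr; linarith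
        have h5 : -(ε / 2) ≤ ε / 2 * U n x₀ := by nlinarith
        show 0 ≤ _
        rw [h3]
        linarith)
    linarith
  have hnt : ∃ x, v x ≤ -1 := by
    have hsub : ∀ n, V n ⁻¹' Iic (-1) ⊆ closure Ω := fun n x hx => by
      by_contra hxn
      have h1 := hLout x fun h => hxn (subset_closure h)
      have h2 := hLV n x
      have h3 : V n x ≤ -1 := hx
      linarith
    have hcl : ∀ n, IsClosed (V n ⁻¹' Iic (-1)) := fun n => (hVlsc n).isClosed_preimage _
    obtain ⟨x, hx⟩ := IsCompact.nonempty_iInter_of_directed_nonempty_isCompact_isClosed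
      (fun n => V n ⁻¹' Iic (-1))
      (directed_of_isDirected_le fun i j hij x hx => (hVmono i j hij x).trans hx) hlow
      (fun n => hbd.isCompact_closure.of_isClosed_subset (hcl n) (hsub n)) hcl
    exact ⟨x, ciSup_le fun n => mem_iInter.1 hx n⟩
  obtain ⟨xb, hxb⟩ := hnt
  refine ⟨v, lowerSemicontinuous_ciSup hbdd hVlsc, hv0, ⟨xb, ?_, by linarith⟩, hvout, ?_⟩
  · by_contra h
    have := hvout xb h
    linarith
  -- supersolution
  intro x₀ hx₀ φ hφ hmin
  have hmin' : ∀ᶠ x in 𝓝 x₀, v x₀ - φ x₀ ≤ v x - φ x := hmin.isLocalMin (hΩ.mem_nhds hx₀)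
  suffices hmain : Fop k H φ x₀ + m * max (v x₀) (-1) ≤ 0 by
    have := mul_le_mul_of_nonneg_left (le_max_left (v x₀) (-1)) hm
    unfold Fop at hmain
    linarith
  rcases (hv0 x₀).lt_or_eq with hneg | hzero
  swap
  · have h1 : IsLocalMax (fun y => φ y - (fun _ : Eu N => (0 : ℝ)) y) x₀ := by
      filter_upwards [hmin'] with y hy
      have := hv0 y
      linarith
    have h2 := Fop_mono k H hk hφ contDiffAt_const h1
    have h3 : Fop k H (fun _ : Eu N => (0 : ℝ)) x₀ ≤ 0 := by
      obtain ⟨ξ, hξ⟩ := exists_frame (N := N) k hk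
      have h4 := Pminus_le k (fun _ : Eu N => (0 : ℝ)) x₀ ξ hξ
      simp only [Hess_const, Finset.sum_const_zero] at h4
      have h5 := hSC2 x₀ hx₀ 0 le_rfl 0
      rw [zero_smul, zero_mul] at h5
      unfold Fop
      rw [grad_const, h5]
      linarith
    rw [hzero]
    norm_num
    linarith
  by_contra hcon
  push Not at hcon
  obtain ⟨η, hη, hηlt⟩ : ∃ η > 0, 0 < Fop k H φ x₀ + m * max (v x₀) (-1) - 2 * k * η := by
    set A := Fop k H φ x₀ + m * max (v x₀) (-1)
    refine ⟨A / (2 * k + 1), by positivity, ?_⟩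
    have : 2 * (k : ℝ) * (A / (2 * k + 1)) < A := by
      rw [mul_div_assoc', div_lt_iff₀ (by positivity)]
      nlinarith
    linarith
  set a := v x₀ - φ x₀ with ha
  set ψ : ℝ → Eu N → ℝ := fun δ y => φ y + (-η * ‖y - x₀‖ ^ 2 + (a + δ)) with hψ
  have hψx₀ : ∀ δ, ψ δ x₀ = v x₀ + δ := fun δ => by
    simp [hψ, ha]
    ring
  have hψd : ∀ δ x, ContDiffAt ℝ 2 φ x → ContDiffAt ℝ 2 (ψ δ) x := fun δ x h =>
    pert_contDiff h (-η) (a + δ)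
  have hψδ : ∀ δ x, ψ δ x = ψ 0 x + δ := fun δ x => by simp only [hψ]; ring
  have hFδ : ∀ δ x, ContDiffAt ℝ 2 φ x → Fop k H (ψ 0) x ≤ Fop k H (ψ δ) x := fun δ x h =>
    Fop_mono k H hk (hψd 0 x h) (hψd δ x h) (by
      refine Eventually.of_forall fun y => ?_
      show ψ 0 y - ψ δ y ≤ ψ 0 x - ψ δ x
      rw [hψδ δ y, hψδ δ x]
      linarith)
  have hF0 : 0 < Fop k H (ψ 0) x₀ + m * max (ψ 0 x₀) (-1) := by
    rw [hψx₀, add_zero]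
    simp only [hψ]
    rw [Fop_pert k H hk hφ]
    linarith
  obtain ⟨ε, hε, hεF⟩ := exists_between hF0
  have hcψ : ContinuousAt (ψ 0) x₀ := (hψd 0 x₀ hφ).continuousAt
  have hev1 : ∀ᶠ x in 𝓝 x₀, ε < Fop k H (ψ 0) x + m * max (ψ 0 x) (-1) := by
    have hc : ContinuousAt (fun x => Fop k H (ψ 0) x + m * max (ψ 0 x) (-1)) x₀ :=
      (Fop_cont k H hk hΩ hH hx₀ (hψd 0 x₀ hφ)).add
        (continuousAt_const.mul (hcψ.max continuousAt_const))
    exact hc.eventually_const_lt hεF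
  have hev2 : ∀ᶠ x in 𝓝 x₀, ψ 0 x < v x₀ / 2 :=
    hcψ.eventually_lt_const (by rw [hψx₀]; linarith)
  obtain ⟨r, hr, hball⟩ := Metric.nhds_basis_closedBall.eventually_iff.1
    (((hev1.and hev2).and (hφ.eventually (by simp))).and hmin')
  set δ := min (η * r ^ 2 / 8) (-(v x₀ / 2)) with hδ
  have hδ0 : 0 < δ := lt_min (by positivity) (by linarith)
  -- uniform separation on the annulus
  set A : Set (Eu N) := closedBall x₀ r ∩ {x | r / 2 ≤ dist x x₀} with hA
  have hAc : IsCompact A := (isCompact_closedBall x₀ r).inter_right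
    (isClosed_le continuous_const (continuous_id.dist continuous_const))
  have hsep : ∃ n, ∀ x ∈ A, ψ δ x ≤ V n x := by
    refine hAc.induction_on (p := fun S => ∃ n, ∀ x ∈ S, ψ δ x ≤ V n x) ⟨0, by simp⟩ ?_ ?_ ?_
    · rintro s t hst ⟨n, hn⟩
      exact ⟨n, fun x hx => hn x (hst hx)⟩
    · rintro s t ⟨n, hn⟩ ⟨j, hj⟩
      refine ⟨max n j, fun x hx => ?_⟩
      rcases hx with hx | hx
      · exact (hn x hx).trans (hVmono _ _ (le_max_left _ _) x)
      · exact (hj x hx).trans (hVmono _ _ (le_max_right _ _) x)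
    · rintro x ⟨hxr, hxr2⟩
      obtain ⟨⟨⟨-, -⟩, hx3⟩, hx4⟩ := hball hxr
      have hlt : ψ δ x < v x := by
        have h1 : η * (r / 2) ^ 2 ≤ η * ‖x - x₀‖ ^ 2 := by
          have : r / 2 ≤ ‖x - x₀‖ := by rw [← dist_eq_norm]; exact hxr2
          gcongr
        have h2 : δ ≤ η * r ^ 2 / 8 := min_le_left _ _
        have h3 : 0 < η * r ^ 2 := by positivity
        simp only [hψ]
        linarith
      obtain ⟨c, hc1, hc2⟩ := exists_between hlt
      obtain ⟨n, hn⟩ := exists_lt_of_lt_ciSup hc2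
      refine ⟨{y | ψ δ y ≤ V n y}, mem_nhdsWithin_of_mem_nhds ?_, n, fun y hy => hy⟩
      filter_upwards [hVlsc n x c hn, (hψd δ x hx3).continuousAt.eventually_lt_const hc1]
        with y h1 h2
      exact h2.le.trans h1.le
  obtain ⟨n₁, hn₁⟩ := hsep
  obtain ⟨n₂, hn₂⟩ := exists_nat_one_div_lt hε
  set n := max n₁ n₂ with hn
  have hnε : 1 / ((n : ℝ) + 1) ≤ ε := by
    refine le_trans ?_ hn₂.le
    have : (n₂ : ℝ) ≤ n := by exact_mod_cast le_max_right n₁ n₂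
    gcongr
  have hfin := bump k H Ω hk hr (hU n) (hUmax n) (ψ := ψ δ)
    (fun x hx => hψd δ x (hball hx).1.2)
    (fun x hx => by
      have h1 := (hball hx).1.1.2
      have h2 : δ ≤ -(v x₀ / 2) := min_le_right _ _
      rw [hψδ]
      linarith)
    (fun x hx => by
      have h1 := (hball hx).1.1.1
      have h2 := hFδ δ x (hball hx).1.2
      have h3 : Gn m n (ψ δ x) ≤ Gn m n (ψ 0 x) := Gn_anti hm n (by rw [hψδ δ]; linarith)
      have h4 : Gn m n (ψ 0 x) = 1 / ((n : ℝ) + 1) - m * max (ψ 0 x) (-1) := rfl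
      linarith)
    (fun x hx hx2 => (hn₁ x ⟨hx, hx2⟩).trans
      ((hVmono _ _ (le_max_left _ _) x).trans (hVU n x))) hΩ
  have h1 : ψ δ x₀ ≤ V n x₀ := le_lEnv_cont (hψd δ x₀ hφ).continuousAt hfin
  have h2 := hVv n x₀
  rw [hψx₀] at h1
  linarith

end Main

/-- `μ̄ₖ⁻(Ω)` is finite, and if moreover `Ω ∈ 𝒞_R` with `bR < k`, there is
a nontrivial nonpositive viscosity supersolution of
`𝒫⁻ₖ(D²v) + H(x,∇v) + μ̄ₖ⁻(Ω) v = 0` vanishing on `∂Ω`. -/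
theorem statement14 {N : ℕ} (hN : 2 ≤ N) (k : ℕ) (hk1 : 1 ≤ k) (hkN : k < N)
    (Ω : Set (EuclideanSpace ℝ (Fin N))) (hΩopen : IsOpen Ω)
    (hΩbdd : Bornology.IsBounded Ω) (hne : Ω.Nonempty)
    (H : EuclideanSpace ℝ (Fin N) → EuclideanSpace ℝ (Fin N) → ℝ)
    (hHcont : ContinuousOn (Function.uncurry H)
      (Ω ×ˢ (univ : Set (EuclideanSpace ℝ (Fin N)))))
    (hSC2 : SC2 Ω H) (hSC3 : SC3 Ω H)
    (b : ℝ) (hb : 0 ≤ b) (hSC1 : SC1 Ω H b) :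
    ∃ m : ℝ, (m : EReal) = muBarMinus k Ω H ∧
      ∀ R : ℝ, 0 < R → HulaHoop R Ω → b * R < (k : ℝ) →
        ∃ v : EuclideanSpace ℝ (Fin N) → ℝ,
          LowerSemicontinuousOn v (closure Ω) ∧
          (∀ x ∈ closure Ω, v x ≤ 0) ∧
          (∃ x ∈ closure Ω, v x ≠ 0) ∧
          (∀ x ∈ frontier Ω, v x = 0) ∧
          IsViscSupersol (Pminus k) Ω H m (fun _ => 0) v := by
  have hk : k ≤ N := hkN.le
  have h0 : ((0 : ℝ) : EReal) ≤ muBarMinus k Ω H := by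
    refine le_sSup ⟨0, rfl, fun _ => -1, continuous_const.upperSemicontinuous.upperSemicontinuousOn _,
      fun _ _ => by norm_num, ?_⟩
    intro x hx φ hφ hmax
    have h1 := Fop_mono k H hk (φ := fun _ => -1) contDiffAt_const hφ
      (hmax.isLocalMax (hΩopen.mem_nhds hx))
    have h2 : (0 : ℝ) ≤ Pminus k (fun _ : EuclideanSpace ℝ (Fin N) => (-1 : ℝ)) x :=
      le_Pminus k hk _ _ _ fun ξ _ => by simp [Hess_const]
    have h3 : H x 0 = 0 := by
      have := hSC2 x hx 0 le_rfl 0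
      simpa using this
    unfold Fop at h1
    rw [grad_const, h3] at h1
    linarith
  obtain ⟨x₀, hx₀⟩ := hne
  obtain ⟨r, hr, hball⟩ := Metric.nhds_basis_closedBall.mem_iff.1 (hΩopen.mem_nhds hx₀)
  have hA : muBarMinus k Ω H ≤ (((8 + 4 * k + 4 * b * r) ^ 2 / (32 * r ^ 2) : ℝ) : EReal) := by
    refine sSup_le ?_
    rintro _ ⟨μ, rfl, w, hw, hneg, hsub⟩
    exact EReal.coe_le_coe_iff.2 (upper_bound k hk1 hk hb hSC1 hr hball hw hneg hsub)
  have hco : (((muBarMinus k Ω H).toReal : ℝ) : EReal) = muBarMinus k Ω H :=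
    EReal.coe_toReal (ne_top_of_le_ne_top (EReal.coe_ne_top _) hA)
      (ne_bot_of_le_ne_bot (EReal.coe_ne_bot _) h0)
  refine ⟨(muBarMinus k Ω H).toReal, hco, ?_⟩
  intro R hR hhoop hbR
  have hm : 0 ≤ (muBarMinus k Ω H).toReal := by
    rw [← hco] at h0
    exact EReal.coe_le_coe_iff.1 h0
  have hle : ∀ μ : ℝ, (μ : EReal) ≤ muBarMinus k Ω H → μ ≤ (muBarMinus k Ω H).toReal := by
    intro μ h
    rw [← hco] at h
    exact EReal.coe_le_coe_iff.1 h
  generalize (muBarMinus k Ω H).toReal = m at hm hle ⊢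
  obtain ⟨L, hLc, hL0, hLout, hL⟩ := barrier k H Ω hk hΩopen ⟨x₀, hx₀⟩ hHcont hb hSC1 hR hhoop hbR
    (M := 1 + m) (by linarith)
  obtain ⟨v, hv1, hv2, ⟨x, hx, hvx⟩, hv4, hv5⟩ := exists_super k H Ω hk hΩopen hΩbdd hHcont hSC2 hm
    hLc hL0 hLout (fun n => hL _ (Gn_anti hm n) (Gn_cont m n) (Gn_le hm n))
    (fun μ w hw hneg hsub => hle μ (le_sSup
      ⟨μ, rfl, w, hw.upperSemicontinuousOn _, fun x _ => hneg x, hsub⟩))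
  refine ⟨v, hv1.lowerSemicontinuousOn _, fun x _ => hv2 x, ⟨x, subset_closure hx, hvx⟩,
    fun y hy => hv4 y fun hyΩ => ?_, hv5⟩
  rw [hΩopen.frontier_eq] at hy
  exact hy.2 hyΩ
end
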